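/- arXiv:1201.6576 — 3 statements merged into one kernel-verified Lean document; each statement's English description precedes it below -/
import Mathlib

section
/- Let n ≥ 1 be an integer. For a partition σ of [±n], define Abs(σ) to be the collection of sets {|x| : x ∈ V} for V a block of σ. Then Abs maps NC_B(n) onto NC(n), and for every π in NC(n) the number of σ in NC_B(n) with Abs(σ) = π equals n + 1; in particular #NC_B(n) = (n+1)·#NC(n). -/
open Finset

/-- A finpartition of a linearly ordered set is non-crossing if there are no
`a < b < c < d` with `a, c` in one block and `b, d` in a different block. -/
def IsNoncrossing {n : ℕ} (π : Finpartition (Finset.univ : Finset (Fin n))) : Prop :=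
  ∀ a b c d : Fin n, a < b → b < c → c < d →
    ∀ B ∈ π.parts, ∀ C ∈ π.parts, a ∈ B → c ∈ B → b ∈ C → d ∈ C → B = C

/-- Filter by an arbitrary (possibly non-decidable) predicate. -/
noncomputable def fil {α : Type*} (s : Finset α) (p : α → Prop) : Finset α :=
  letI := Classical.decPred p
  s.filter p

/-- Negation on `[±n] = {1,…,n,-1,…,-n}`, identified with `Fin (2n)` via
`i ↦ i - 1` and `-i ↦ n + i - 1` (zero-based).  It is given by adding `n` modulo `2n`. -/
def negB {n : ℕ} (x : Fin (2 * n)) : Fin (2 * n) :=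
  ⟨(x.val + n) % (2 * n), Nat.mod_lt _ (by have := x.isLt; omega)⟩

/-- `-V` for a block `V`. -/
def negBlock {n : ℕ} (V : Finset (Fin (2 * n))) : Finset (Fin (2 * n)) :=
  V.image negB

/-- `NCB n` : non-crossing partitions of type `B_n`, i.e. non-crossing partitions
of `[±n]` such that `-V` is a block whenever `V` is, with at most one block `V`
satisfying `-V = V` (the zero-block). -/
noncomputable def NCB (n : ℕ) : Finset (Finpartition (Finset.univ : Finset (Fin (2 * n)))) :=
  fil Finset.univ (fun π => IsNoncrossing π ∧ (∀ B ∈ π.parts, negBlock B ∈ π.parts) ∧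
    (π.parts.filter (fun B => negBlock B = B)).card ≤ 1)

/-- The number of unordered pairs `{V, -V}` of non-zero blocks of `π` with `|V| = t`. -/
def pairCount {n : ℕ} (π : Finpartition (Finset.univ : Finset (Fin (2 * n)))) (t : ℕ) : ℕ :=
  (π.parts.filter (fun B => negBlock B ≠ B ∧ B.card = t)).card / 2

/-- The number of unordered pairs `{V, -V}` of non-zero blocks of `π` (of any size). -/
def totalPairCount {n : ℕ} (π : Finpartition (Finset.univ : Finset (Fin (2 * n)))) : ℕ :=
  (π.parts.filter (fun B => negBlock B ≠ B)).card / 2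

/-- The cardinality of the zero-block of `π` (`0` if there is no zero-block). -/
def zeroBlockSize {n : ℕ} (π : Finpartition (Finset.univ : Finset (Fin (2 * n)))) : ℕ :=
  ∑ B ∈ π.parts.filter (fun B => negBlock B = B), B.card

/-- `NCBdiv k n` : the `k`-divisible non-crossing partitions of type `B_{kn}`. -/
noncomputable def NCBdiv (k n : ℕ) :
    Finset (Finpartition (Finset.univ : Finset (Fin (2 * (k * n))))) :=
  fil (NCB (k * n)) (fun π => ∀ B ∈ π.parts, k ∣ B.card)

/-- `NC n` : the set of non-crossing partitions of `{1,…,n}`. -/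
noncomputable def NC (n : ℕ) : Finset (Finpartition (Finset.univ : Finset (Fin n))) :=
  fil Finset.univ IsNoncrossing

/-- The absolute-value map `[±n] → {1,…,n}`: under the identification of `[±n]` with
`Fin (2n)` (`i ↦ i - 1`, `-i ↦ n + i - 1`, zero-based) it is reduction modulo `n`. -/
def absMap {n : ℕ} (x : Fin (2 * n)) : Fin n :=
  ⟨x.val % n, Nat.mod_lt _ (by have := x.isLt; omega)⟩

/-- `Abs(σ)` : the collection of sets `{|x| : x ∈ V}` for `V` a block of `σ`. -/
def absParts {n : ℕ} (σ : Finpartition (Finset.univ : Finset (Fin (2 * n)))) :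
    Finset (Finset (Fin n)) :=
  σ.parts.image (fun B => B.image absMap)


def NatNC {α : Type*} (N : ℕ) (f : ℕ → α) : Prop :=
  ∀ a b c d, a < b → b < c → c < d → d < N → f a = f c → f b = f d → f a = f b

def NegSym {α : Type*} (n : ℕ) (q : ℕ → α) : Prop :=
  ∀ i j, i < n → j < n → ((q i = q j → q (i + n) = q (j + n)) ∧ (q (i + n) = q (j + n) → q i = q j) ∧
    (q i = q (j + n) → q (i + n) = q j))

def AbsRel {α β : Type*} (n : ℕ) (p : ℕ → α) (q : ℕ → β) : Prop :=
  ∀ i j, i < n → j < n → (p i = p j ↔ (q i = q j ∨ q i = q (j + n)))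

/-- `k` is the least `q` having a partner `j ≤ q` on the opposite sheet (`k = n` if there is none). -/
def CharK {β : Type*} (n : ℕ) (q : ℕ → β) (k : ℕ) : Prop :=
  k ≤ n ∧ (∀ i < k, ∀ j ≤ i, q i ≠ q (j + n)) ∧ (k < n → ∃ j ≤ k, q k = q (j + n))

theorem charK_unique {β : Type*} {n : ℕ} {q : ℕ → β} {k l : ℕ} (hk : CharK n q k)
    (hl : CharK n q l) : k = l := by
  obtain ⟨h1, h2, h3⟩ := hk
  obtain ⟨g1, g2, g3⟩ := hl
  rcases lt_trichotomy k l with h | h | h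
  · obtain ⟨j, hj, e⟩ := h3 (by omega)
    exact absurd e (g2 k h j hj)
  · exact h
  · obtain ⟨j, hj, e⟩ := g3 (by omega)
    exact absurd e (h2 l h j hj)

theorem charK_exists {β : Type*} (n : ℕ) (q : ℕ → β) : ∃ k, CharK n q k := by
  classical
  have hex : ∃ k, k = n ∨ ∃ j ≤ k, q k = q (j + n) := ⟨n, Or.inl rfl⟩
  have hle : Nat.find hex ≤ n := Nat.find_min' hex (Or.inl rfl)
  refine ⟨Nat.find hex, hle, ?_, ?_⟩
  · intro i hi j hj e
    exact Nat.find_min hex hi (Or.inr ⟨j, hj, e⟩)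
  · intro h
    exact (Nat.find_spec hex).resolve_left (by omega)

/-- Special label set: the block of `k` when `k` is the minimum of its block. -/
def Spec {α : Type*} (n : ℕ) (p : ℕ → α) (k i : ℕ) : Prop :=
  k < n ∧ (∀ j < k, p j ≠ p k) ∧ p i = p k

open Classical in
/-- Label function of the lift. -/
noncomputable def rlab {α : Type*} (n : ℕ) (p : ℕ → α) (k x : ℕ) : α × Bool :=
  (p (x % n), if Spec n p k (x % n) then false else decide (k ≤ x ∧ x < k + n))

theorem rlab_eq {α : Type*} {n : ℕ} {p : ℕ → α} {k x y : ℕ} :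
    rlab n p k x = rlab n p k y ↔ p (x % n) = p (y % n) ∧
      (Spec n p k (x % n) ∨ ((k ≤ x ∧ x < k + n) ↔ (k ≤ y ∧ y < k + n))) := by
  unfold rlab
  rw [Prod.mk.injEq]
  refine and_congr_right fun h => ?_
  have : Spec n p k (x % n) ↔ Spec n p k (y % n) := by unfold Spec; rw [h]
  by_cases hs : Spec n p k (x % n)
  · simp [hs, this.1 hs]
  · have hs' : ¬ Spec n p k (y % n) := fun h => hs (this.2 h)
    simp only [hs, hs', if_false, false_or, decide_eq_decide]

theorem mod_cases {n x : ℕ} (h : x < 2 * n) : (x < n ∧ x % n = x) ∨ (n ≤ x ∧ x % n = x - n) := by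
  by_cases hx : x < n
  · left; exact ⟨hx, Nat.mod_eq_of_lt hx⟩
  · right
    refine ⟨by omega, ?_⟩
    rw [Nat.mod_eq_sub_mod (by omega), Nat.mod_eq_of_lt (by omega)]

theorem nc_cyc {α : Type*} {n : ℕ} {p : ℕ → α} (hp : NatNC n p) {a b c d : ℕ}
    (ha : a < n) (hb : b < n) (hc : c < n) (hd : d < n)
    (h : (a < b ∧ b < c ∧ c < d) ∨ (b < c ∧ c < d ∧ d < a) ∨ (c < d ∧ d < a ∧ a < b) ∨
      (d < a ∧ a < b ∧ b < c)) (h1 : p a = p c) (h2 : p b = p d) : p a = p b := by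
  rcases h with h | h | h | h
  · exact hp a b c d h.1 h.2.1 h.2.2 hd h1 h2
  · have := hp b c d a h.1 h.2.1 h.2.2 ha h2 h1.symm
    rw [h1, this]
  · have := hp c d a b h.1 h.2.1 h.2.2 hb h1.symm h2.symm
    rw [h1, this, h2]
  · have := hp d a b c h.1 h.2.1 h.2.2 hc h2.symm h1
    rw [h2, this]

/-- the shape of abs -/
theorem abs_nc {α β : Type*} {n : ℕ} {p : ℕ → α} {q : ℕ → β} (hq : NatNC (2 * n) q)
    (hs : NegSym n q) (ha : AbsRel n p q) : NatNC n p := by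
  intro a b c d hab hbc hcd hd h1 h2
  have hac := (ha a c (by omega) (by omega)).1 h1
  have hbd := (ha b d (by omega) (by omega)).1 h2
  rcases hac with hac | hac
  · rw [ha a b (by omega) (by omega)]
    left
    rcases hbd with hbd | hbd
    · exact hq a b c d hab hbc hcd (by omega) hac hbd
    · exact hq a b c (d + n) hab hbc (by omega) (by omega) hac hbd
  · rcases hbd with hbd | hbd
    · have h3 := (hs a c (by omega) (by omega)).2.2 hac
      have := hq b c d (a + n) hbc hcd (by omega) (by omega) hbd h3.symm
      rw [h1]
      exact ((ha b c (by omega) (by omega)).2 (Or.inl this)).symm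
    · rw [ha a b (by omega) (by omega)]
      left
      exact hq a b (c + n) (d + n) hab (by omega) (by omega) (by omega) hac hbd

theorem rlab_abs {α : Type*} {n : ℕ} {p : ℕ → α} {k : ℕ} :
    AbsRel n p (rlab n p k) := by
  intro i j hi hj
  rw [rlab_eq, rlab_eq, Nat.add_mod_right, Nat.mod_eq_of_lt hi, Nat.mod_eq_of_lt hj]
  by_cases h : p i = p j
  · simp only [h, true_and, true_iff]
    by_cases hs : Spec n p k i
    · exact Or.inl (Or.inl hs)
    · by_cases h' : ((k ≤ i ∧ i < k + n) ↔ (k ≤ j ∧ j < k + n))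
      · exact Or.inl (Or.inr h')
      · right; right; omega
  · simp [h]

theorem rlab_sym {α : Type*} {n : ℕ} {p : ℕ → α} {k : ℕ} (hk : k ≤ n) :
    NegSym n (rlab n p k) := by
  intro i j hi hj
  simp only [rlab_eq, Nat.add_mod_right, Nat.mod_eq_of_lt hi, Nat.mod_eq_of_lt hj]
  refine ⟨fun h => ⟨h.1, h.2.imp id ?_⟩, fun h => ⟨h.1, h.2.imp id ?_⟩, fun h => ⟨h.1, h.2.imp id ?_⟩⟩
    <;> omega

theorem rlab_char {α : Type*} {n : ℕ} {p : ℕ → α} {k : ℕ} (hk : k ≤ n) :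
    CharK n (rlab n p k) k := by
  refine ⟨hk, ?_, ?_⟩
  · intro i hi j hj
    rw [Ne, rlab_eq, Nat.add_mod_right, Nat.mod_eq_of_lt (by omega), Nat.mod_eq_of_lt (by omega)]
    rintro ⟨h1, h2 | h2⟩
    · exact h2.2.1 i hi h2.2.2
    · omega
  · intro hkn
    by_cases hm : ∀ j < k, p j ≠ p k
    · refine ⟨k, le_rfl, ?_⟩
      rw [rlab_eq, Nat.add_mod_right, Nat.mod_eq_of_lt (by omega)]
      exact ⟨rfl, Or.inl ⟨hkn, hm, rfl⟩⟩
    · push Not at hm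
      obtain ⟨j, hj, e⟩ := hm
      refine ⟨j, hj.le, ?_⟩
      rw [rlab_eq, Nat.add_mod_right, Nat.mod_eq_of_lt (by omega), Nat.mod_eq_of_lt (by omega)]
      refine ⟨e.symm, Or.inr ?_⟩
      omega

set_option maxHeartbeats 4000000 in
/-- a nonspecial pair separated by an element of the special block is special -/
theorem rlab_nc {α : Type*} {n : ℕ} {p : ℕ → α} {k : ℕ} (hk : k ≤ n) (hp : NatNC n p) :
    NatNC (2 * n) (rlab n p k) := by
  intro a b c d hab hbc hcd hd h1 h2
  rw [rlab_eq] at h1 h2 ⊢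
  have key : p (a % n) = p (b % n) := by
    obtain ⟨h1, h1'⟩ := h1
    obtain ⟨h2, h2'⟩ := h2
    have ma := mod_cases (n := n) (x := a) (by omega)
    have mb := mod_cases (n := n) (x := b) (by omega)
    have mc := mod_cases (n := n) (x := c) (by omega)
    have md := mod_cases (n := n) (x := d) (by omega)
    generalize a % n = a' at *
    generalize b % n = b' at *
    generalize c % n = c' at *
    generalize d % n = d' at *
    rcases h1' with h1' | h1' <;> rcases h2' with h2' | h2'
    · rw [h1'.2.2, h2'.2.2]
    · obtain ⟨hkn, hm, e⟩ := h1'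
      have ec : p c' = p k := h1 ▸ e
      by_contra hne
      have b1 : b' ≠ k := by rintro rfl; exact hne e
      have d1 : d' ≠ k := by rintro rfl; exact hne (by rw [e, h2])
      by_cases hw : b < k ∧ k + n ≤ d
      · have := nc_cyc hp (a := k) (b := d') (c := a') (d := b') (by omega) (by omega) (by omega)
          (by omega) (by omega) e.symm h2.symm
        exact hne (by rw [e, this, h2])
      · have := nc_cyc hp (a := k) (b := b') (c := c') (d := d') (by omega) (by omega) (by omega)
          (by omega) (by omega) ec.symm h2
        exact hne (by rw [e, this])
    · obtain ⟨hkn, hm, e⟩ := h2'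
      have ed : p d' = p k := h2 ▸ e
      by_contra hne
      have a1 : a' ≠ k := by rintro rfl; exact hne e.symm
      have c1 : c' ≠ k := by rintro rfl; exact hne (by rw [e, h1])
      by_cases hw : a < k ∧ k + n ≤ c
      · have := nc_cyc hp (a := k) (b := c') (c := d') (d := a') (by omega) (by omega) (by omega)
          (by omega) (by omega) ed.symm h1.symm
        exact hne (by rw [e, this, h1])
      · have := nc_cyc hp (a := k) (b := a') (c := b') (d := c') (by omega) (by omega) (by omega)
          (by omega) (by omega) e.symm h1
        exact hne (by rw [e, this])
    · by_cases hw : ((k ≤ a ∧ a < k + n) ↔ (k ≤ b ∧ b < k + n))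
      · refine nc_cyc hp (by omega) (by omega) (by omega) (by omega) ?_ h1 h2
        omega
      · omega
  refine ⟨key, ?_⟩
  rcases h1.2 with h1' | h1'
  · exact Or.inl h1'
  · rcases h2.2 with h2' | h2'
    · exact Or.inl ⟨h2'.1, h2'.2.1, by rw [key, h2'.2.2]⟩
    · right; omega

section uniq
variable {α β : Type*} {n : ℕ} {p : ℕ → α} {q : ℕ → β} {k : ℕ}

theorem uniq_E (hq : NatNC (2 * n) q) (hs : NegSym n q) (hk : CharK n q k)
    {i j : ℕ} (hi : i < k) (hj : k ≤ j) (hjn : j < n) : q i ≠ q j := by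
  intro e
  obtain ⟨h1, h2, h3⟩ := hk
  obtain ⟨m, hm, em⟩ := h3 (by omega)
  have e1 : q i = q k := by
    rcases hj.eq_or_lt with h | h
    · rw [e, h]
    · exact hq i k j (m + n) hi h (by omega) (by omega) e em
  rcases le_or_gt m i with h | h
  · exact h2 i hi m h (e1.trans em)
  · have e2 := (hs i m (by omega) (by omega)).2.2 (e1.trans em)
    rcases hm.eq_or_lt with h' | h'
    · subst h'
      exact h2 i hi i le_rfl (by rw [e2, e1])
    · exact h2 m h' i h.le e2.symm

theorem uniq_D_aux (hq : NatNC (2 * n) q) (hs : NegSym n q) (ha : AbsRel n p q)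
    (hk : CharK n q k) {i j : ℕ} (hin : i < n) (hkj : k ≤ j) (hji : j ≤ i)
    (e : q i = q (j + n)) : Spec n p k i := by
  have hE := @uniq_E _ n q k hq hs hk
  obtain ⟨h1, h2, h3⟩ := hk
  obtain ⟨m, hm, em⟩ := h3 (by omega)
  have e1 : q k = q i := by
    by_cases h : k = i
    · rw [h]
    · by_cases h' : m = j
      · rw [em, e, h']
      · exact hq k i (m + n) (j + n) (by omega) (by omega) (by omega) (by omega) em e
  have e2 : q m = q j := (hs m j (by omega) (by omega)).2.1 (by rw [← em, e1, e])
  have hmk : m = k := by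
    by_contra h
    exact hE (i := m) (j := j) (by omega) hkj (by omega) e2
  subst hmk
  refine ⟨by omega, ?_, (ha i m hin (by omega)).2 (Or.inl e1.symm)⟩
  intro l hl hp
  refine hE (i := l) (j := m) hl le_rfl (by omega) ?_
  rcases (ha l m (by omega) (by omega)).1 hp with h | h
  · exact h
  · rw [h, em]

theorem uniq_D (hq : NatNC (2 * n) q) (hs : NegSym n q) (ha : AbsRel n p q)
    (hk : CharK n q k) {i j : ℕ} (hin : i < n) (hjn : j < n)
    (e : q i = q (j + n)) : Spec n p k i ∨ (k ≤ i ↔ j < k) := by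
  by_cases hi : k ≤ i <;> by_cases hj : k ≤ j
  · left
    rcases le_total j i with h | h
    · exact uniq_D_aux hq hs ha hk hin hj h e
    · have := uniq_D_aux hq hs ha hk hjn hi h ((hs i j hin hjn).2.2 e).symm
      exact ⟨this.1, this.2.1, by rw [(ha i j hin hjn).2 (Or.inr e), this.2.2]⟩
  · right; omega
  · right; omega
  · exfalso
    rcases le_total j i with h | h
    · exact hk.2.1 i (by omega) j h e
    · exact hk.2.1 j (by omega) i h ((hs i j hin hjn).2.2 e).symm

theorem spec_zero (hs : NegSym n q) (ha : AbsRel n p q)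
    (hk : CharK n q k) {i : ℕ} (hin : i < n) (h : Spec n p k i) : q i = q (i + n) := by
  obtain ⟨h1, h2, h3⟩ := h
  obtain ⟨m, hm, em⟩ := hk.2.2 h1
  have hmk : m = k := by
    by_contra h
    exact h2 m (by omega) ((ha k m h1 (by omega)).2 (Or.inr em)).symm
  subst hmk
  have e : q i = q m := by
    rcases (ha i m hin h1).1 h3 with h | h
    · exact h
    · rw [h, em]
  rw [(hs i m hin h1).1 e, e, em]

/-- the dichotomy for pairs in terms of base points and sheets -/
theorem uniq_fwd (hq : NatNC (2 * n) q) (hs : NegSym n q) (ha : AbsRel n p q)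
    (hk : CharK n q k) {x y : ℕ} (hx : x < 2 * n) (hy : y < 2 * n) (e : q x = q y) :
    rlab n p k x = rlab n p k y := by
  rw [rlab_eq]
  have hE : ∀ i j, i < n → j < n → q i = q j → (k ≤ i ↔ k ≤ j) := by
    intro i j hi hj e
    by_cases h1 : k ≤ i <;> by_cases h2 : k ≤ j <;> simp only [h1, h2]
    · exact absurd e.symm (uniq_E hq hs hk (by omega) h1 hi)
    · exact absurd e (uniq_E hq hs hk (by omega) h2 hj)
  have hD := fun i j => @uniq_D _ _ n p q k hq hs ha hk i j
  have hkn := hk.1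
  rcases mod_cases hx with ⟨x1, x2⟩ | ⟨x1, x2⟩ <;> rcases mod_cases hy with ⟨y1, y2⟩ | ⟨y1, y2⟩ <;>
    rw [x2, y2]
  · refine ⟨(ha x y x1 y1).2 (Or.inl e), Or.inr ?_⟩
    have := hE x y x1 y1 e
    omega
  · obtain ⟨z, rfl⟩ := Nat.exists_eq_add_of_le' y1
    have hz : z < n := by omega
    rw [Nat.add_sub_cancel]
    refine ⟨(ha x z x1 hz).2 (Or.inr e), (hD x z x1 hz e).imp id ?_⟩
    intro h; omega
  · obtain ⟨z, rfl⟩ := Nat.exists_eq_add_of_le' x1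
    have hz : z < n := by omega
    rw [Nat.add_sub_cancel]
    have e' : q z = q (y + n) := ((hs y z y1 hz).2.2 e.symm).symm
    refine ⟨(ha z y hz y1).2 (Or.inr e'), (hD z y hz y1 e').imp id ?_⟩
    intro h; omega
  · obtain ⟨z, rfl⟩ := Nat.exists_eq_add_of_le' x1
    obtain ⟨w, rfl⟩ := Nat.exists_eq_add_of_le' y1
    have hz : z < n := by omega
    have hw : w < n := by omega
    rw [Nat.add_sub_cancel, Nat.add_sub_cancel]
    have e' := (hs z w hz hw).2.1 e
    refine ⟨(ha z w hz hw).2 (Or.inl e'), Or.inr ?_⟩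
    have := hE z w hz hw e'
    omega

theorem uniq_iff (hq : NatNC (2 * n) q) (hs : NegSym n q) (ha : AbsRel n p q)
    (hk : CharK n q k) {x y : ℕ} (hx : x < 2 * n) (hy : y < 2 * n) :
    q x = q y ↔ rlab n p k x = rlab n p k y := by
  refine ⟨uniq_fwd hq hs ha hk hx hy, fun h => ?_⟩
  have hn : 0 < n := by omega
  have hxn := Nat.mod_lt x hn
  have hyn := Nat.mod_lt y hn
  rw [rlab_eq] at h
  obtain ⟨h1, h2⟩ := h
  have hkn := hk.1
  by_cases hsp : Spec n p k (x % n)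
  · have hsp' : Spec n p k (y % n) := ⟨hsp.1, hsp.2.1, by rw [← h1, hsp.2.2]⟩
    have zx := spec_zero hs ha hk hxn hsp
    have zy := spec_zero hs ha hk hyn hsp'
    have exy : q (x % n) = q (y % n) := by
      rcases (ha _ _ hxn hyn).1 h1 with h | h
      · exact h
      · rw [h, zy]
    have ex : q x = q (x % n) := by
      rcases mod_cases hx with ⟨x1, x2⟩ | ⟨x1, x2⟩
      · rw [x2]
      · rw [zx, x2, Nat.sub_add_cancel x1]
    have ey : q y = q (y % n) := by
      rcases mod_cases hy with ⟨x1, x2⟩ | ⟨x1, x2⟩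
      · rw [x2]
      · rw [zy, x2, Nat.sub_add_cancel x1]
    rw [ex, ey, exy]
  · have h3 : (k ≤ x ∧ x < k + n) ↔ (k ≤ y ∧ y < k + n) := h2.resolve_left hsp
    have hcases := (ha _ _ hxn hyn).1 h1
    have hf := fun a b => @uniq_fwd _ _ n p q k hq hs ha hk a b
    have h5 : ∀ a b, a < 2 * n → b < 2 * n → a % n = x % n → q a = q b →
        ((k ≤ a ∧ a < k + n) ↔ (k ≤ b ∧ b < k + n)) := by
      intro a b ha' hb' e1 e
      have := hf a b ha' hb' e
      rw [rlab_eq, e1] at this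
      exact this.2.resolve_left hsp
    rcases mod_cases hx with ⟨x1, x2⟩ | ⟨x1, x2⟩ <;>
      rcases mod_cases hy with ⟨y1, y2⟩ | ⟨y1, y2⟩ <;> rw [x2, y2] at hcases
    · rcases hcases with h | h
      · exact h
      · have := h5 _ _ hx (by omega) rfl h
        omega
    · rcases hcases with h | h
      · have := h5 _ _ hx (by omega) rfl h
        omega
      · rw [h, Nat.sub_add_cancel y1]
    · rcases hcases with h | h
      · have := h5 _ _ (by omega) (by omega) (by rw [x2, Nat.mod_eq_of_lt (by omega)]) h
        omega
      · have := (hs _ _ (by omega) (by omega)).2.2 h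
        rwa [Nat.sub_add_cancel x1] at this
    · rcases hcases with h | h
      · have := (hs _ _ (by omega) (by omega)).1 h
        rwa [Nat.sub_add_cancel x1, Nat.sub_add_cancel y1] at this
      · have := h5 _ _ (by omega) (by omega) (by rw [x2, Nat.mod_eq_of_lt (by omega)]) h
        omega

end uniq

/-! Finpartition layer -/

theorem mem_fil {α : Type*} {s : Finset α} {p : α → Prop} {x : α} : x ∈ fil s p ↔ x ∈ s ∧ p x := by
  unfold fil
  simp

/-- Block labels, extended to all naturals. -/
def lab {N : ℕ} (π : Finpartition (Finset.univ : Finset (Fin N))) (i : ℕ) : Finset (Fin N) :=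
  if h : i < N then π.part ⟨i, h⟩ else ∅

theorem lab_val {N : ℕ} (π : Finpartition (Finset.univ : Finset (Fin N))) (x : Fin N) :
    lab π x.val = π.part x := by
  simp [lab]

theorem mem_part_iff {N : ℕ} (π : Finpartition (Finset.univ : Finset (Fin N))) (x y : Fin N) :
    x ∈ π.part y ↔ π.part x = π.part y :=
  π.mem_part_iff_part_eq_part (mem_univ _) (mem_univ _)

theorem parts_eq {N : ℕ} (π : Finpartition (Finset.univ : Finset (Fin N))) :
    π.parts = Finset.univ.image π.part := by
  ext B
  simp only [mem_image, mem_univ, true_and]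
  constructor
  · intro hB
    obtain ⟨x, hx⟩ := π.nonempty_of_mem_parts hB
    exact ⟨x, π.part_eq_of_mem hB hx⟩
  · rintro ⟨x, rfl⟩
    exact π.part_mem.2 (mem_univ _)

theorem part_ext {N : ℕ} {π τ : Finpartition (Finset.univ : Finset (Fin N))}
    (h : ∀ i j, i < N → j < N → (lab π i = lab π j ↔ lab τ i = lab τ j)) : π = τ := by
  apply Finpartition.ext
  rw [parts_eq, parts_eq]
  congr 1
  funext y
  ext x
  rw [mem_part_iff, mem_part_iff, ← lab_val, ← lab_val, ← lab_val, ← lab_val]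
  exact h _ _ x.2 y.2

theorem isNoncrossing_iff {N : ℕ} (π : Finpartition (Finset.univ : Finset (Fin N))) :
    IsNoncrossing π ↔ NatNC N (lab π) := by
  constructor
  · intro h a b c d hab hbc hcd hd h1 h2
    have ha : a < N := by omega
    have hb : b < N := by omega
    have hc : c < N := by omega
    simp only [lab, ha, hb, hc, hd, dif_pos] at h1 h2 ⊢
    refine h ⟨a, ha⟩ ⟨b, hb⟩ ⟨c, hc⟩ ⟨d, hd⟩ hab hbc hcd _ (π.part_mem.2 (mem_univ _)) _
      (π.part_mem.2 (mem_univ _)) ?_ ?_ ?_ ?_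
    · rw [mem_part_iff]
    · rw [mem_part_iff, h1]
    · rw [mem_part_iff]
    · rw [mem_part_iff, h2]
  · intro h a b c d hab hbc hcd B hB C hC h1 h2 h3 h4
    have := h a b c d hab hbc hcd d.2
    simp only [lab_val] at this
    rw [π.part_eq_of_mem hB h1, π.part_eq_of_mem hB h2, π.part_eq_of_mem hC h3,
      π.part_eq_of_mem hC h4] at this
    exact this rfl rfl

open Classical in
/-- The partition into fibres of `f`. -/
noncomputable def mkPart {α : Type*} (N : ℕ) (f : ℕ → α) :
    Finpartition (Finset.univ : Finset (Fin N)) :=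
  Finpartition.ofSetoid (Setoid.ker (fun x : Fin N => f x.val))

theorem lab_mkPart {α : Type*} {N : ℕ} {f : ℕ → α} {i j : ℕ} (hi : i < N) (hj : j < N) :
    lab (mkPart N f) i = lab (mkPart N f) j ↔ f i = f j := by
  classical
  simp only [lab, hi, hj, dif_pos]
  rw [← mem_part_iff, mkPart, Finpartition.mem_part_ofSetoid_iff_rel, Setoid.ker_def]
  exact eq_comm

theorem natNC_congr {α β : Type*} {N : ℕ} {f : ℕ → α} {g : ℕ → β}
    (h : ∀ i j, i < N → j < N → (f i = f j ↔ g i = g j)) (hf : NatNC N f) : NatNC N g := by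
  intro a b c d hab hbc hcd hd h1 h2
  rw [← h _ _ (by omega) (by omega)] at h1 h2 ⊢
  exact hf a b c d hab hbc hcd hd h1 h2

theorem negSym_congr {α β : Type*} {n : ℕ} {f : ℕ → α} {g : ℕ → β}
    (h : ∀ i j, i < 2 * n → j < 2 * n → (f i = f j ↔ g i = g j)) (hf : NegSym n f) :
    NegSym n g := by
  intro i j hi hj
  rw [← h _ _ (by omega) (by omega), ← h _ _ (by omega) (by omega), ← h _ _ (by omega) (by omega),
    ← h _ _ (by omega) (by omega)]
  exact hf i j hi hj

theorem absRel_congr {α β γ : Type*} {n : ℕ} {p : ℕ → γ} {f : ℕ → α} {g : ℕ → β}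
    (h : ∀ i j, i < 2 * n → j < 2 * n → (f i = f j ↔ g i = g j)) (hf : AbsRel n p f) :
    AbsRel n p g := by
  intro i j hi hj
  rw [← h _ _ (by omega) (by omega), ← h _ _ (by omega) (by omega)]
  exact hf i j hi hj

theorem charK_congr {α β : Type*} {n k : ℕ} {f : ℕ → α} {g : ℕ → β}
    (h : ∀ i j, i < 2 * n → j < 2 * n → (f i = f j ↔ g i = g j)) (hf : CharK n f k) :
    CharK n g k := by
  obtain ⟨h1, h2, h3⟩ := hf
  refine ⟨h1, ?_, ?_⟩
  · intro i hi j hj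
    rw [Ne, ← h _ _ (by omega) (by omega)]
    exact h2 i hi j hj
  · intro hk
    obtain ⟨j, hj, e⟩ := h3 hk
    exact ⟨j, hj, (h _ _ (by omega) (by omega)).1 e⟩

theorem negB_low {n i : ℕ} (hi : i < n) :
    negB (⟨i, by omega⟩ : Fin (2 * n)) = ⟨i + n, by omega⟩ := by
  apply Fin.ext
  change (i + n) % (2 * n) = i + n
  exact Nat.mod_eq_of_lt (by omega)

theorem negB_high {n i : ℕ} (hi : i < n) :
    negB (⟨i + n, by omega⟩ : Fin (2 * n)) = ⟨i, by omega⟩ := by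
  apply Fin.ext
  change (i + n + n) % (2 * n) = i
  rw [show i + n + n = i + 2 * n by ring, Nat.add_mod_right, Nat.mod_eq_of_lt (by omega)]

theorem negB_cases {n : ℕ} (x : Fin (2 * n)) :
    ∃ i, ∃ hi : i < n, x = ⟨i, by omega⟩ ∨ x = ⟨i + n, by omega⟩ := by
  obtain ⟨x, hx⟩ := x
  by_cases h : x < n
  · exact ⟨x, h, Or.inl rfl⟩
  · exact ⟨x - n, by omega, Or.inr (Fin.ext (by simp; omega))⟩

theorem negB_negB {n : ℕ} (x : Fin (2 * n)) : negB (negB x) = x := by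
  obtain ⟨i, hi, rfl | rfl⟩ := negB_cases x
  · rw [negB_low hi, negB_high hi]
  · rw [negB_high hi, negB_low hi]

section symm
variable {n : ℕ} (σ : Finpartition (Finset.univ : Finset (Fin (2 * n))))

theorem negBlock_iff_fin : (∀ B ∈ σ.parts, negBlock B ∈ σ.parts) ↔
    ∀ x y, σ.part x = σ.part y → σ.part (negB x) = σ.part (negB y) := by
  constructor
  · intro h x y e
    have hB := h _ (σ.part_mem.2 (mem_univ x))
    rw [σ.part_eq_of_mem hB (mem_image_of_mem negB ((mem_part_iff σ x x).2 rfl)),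
      σ.part_eq_of_mem hB (mem_image_of_mem negB ((mem_part_iff σ y x).2 e.symm))]
  · intro h B hB
    rw [parts_eq] at hB ⊢
    simp only [mem_image, mem_univ, true_and] at hB ⊢
    obtain ⟨x, rfl⟩ := hB
    refine ⟨negB x, ?_⟩
    ext y
    simp only [negBlock, mem_image, mem_part_iff]
    constructor
    · intro e
      refine ⟨negB y, ?_, negB_negB y⟩
      have := h _ _ e
      rwa [negB_negB] at this
    · rintro ⟨z, hz, rfl⟩
      exact h _ _ hz

theorem negBlock_iff : (∀ B ∈ σ.parts, negBlock B ∈ σ.parts) ↔ NegSym n (lab σ) := by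
  rw [negBlock_iff_fin]
  have hl : ∀ i (hi : i < n), lab σ i = σ.part ⟨i, by omega⟩ := by
    intro i hi
    exact dif_pos _
  have hh : ∀ i (hi : i < n), lab σ (i + n) = σ.part ⟨i + n, by omega⟩ := by
    intro i hi
    exact dif_pos _
  constructor
  · intro h i j hi hj
    rw [hl i hi, hl j hj, hh i hi, hh j hj]
    refine ⟨fun e => ?_, fun e => ?_, fun e => ?_⟩
    · simpa only [negB_low hi, negB_low hj] using h _ _ e
    · simpa only [negB_high hi, negB_high hj] using h _ _ e
    · simpa only [negB_low hi, negB_high hj] using h _ _ e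
  · intro h x y e
    obtain ⟨i, hi, rfl | rfl⟩ := negB_cases x <;> obtain ⟨j, hj, rfl | rfl⟩ := negB_cases y <;>
      have h1 := h i j hi hj <;> have h2 := h j i hj hi <;>
      simp only [hl _ hi, hl _ hj, hh _ hi, hh _ hj] at h1 h2 <;>
      simp only [negB_low hi, negB_low hj, negB_high hi, negB_high hj]
    · exact h1.1 e
    · exact h1.2.2 e
    · exact (h2.2.2 e.symm).symm
    · exact h1.2.1 e

theorem mem_NCB_iff : σ ∈ NCB n ↔ NatNC (2 * n) (lab σ) ∧ NegSym n (lab σ) := by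
  rw [NCB, mem_fil, isNoncrossing_iff, negBlock_iff]
  refine ⟨fun h => ⟨h.2.1, h.2.2.1⟩, fun h => ⟨mem_univ _, h.1, h.2, ?_⟩⟩
  obtain ⟨hq, hs⟩ := h
  have key : ∀ B ∈ σ.parts, negBlock B = B → ∃ i, i < n ∧ lab σ i = B ∧ lab σ (i + n) = B := by
    intro B hB hz
    obtain ⟨x, hx⟩ := σ.nonempty_of_mem_parts hB
    have hx' : negB x ∈ B := by
      rw [← hz]
      exact mem_image_of_mem _ hx
    obtain ⟨i, hi, rfl | rfl⟩ := negB_cases x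
    · rw [negB_low hi] at hx'
      refine ⟨i, hi, ?_, ?_⟩
      · exact (dif_pos _).trans (σ.part_eq_of_mem hB hx)
      · exact (dif_pos _).trans (σ.part_eq_of_mem hB hx')
    · rw [negB_high hi] at hx'
      refine ⟨i, hi, ?_, ?_⟩
      · exact (dif_pos _).trans (σ.part_eq_of_mem hB hx')
      · exact (dif_pos _).trans (σ.part_eq_of_mem hB hx)
  rw [Finset.card_le_one]
  intro B hB C hC
  rw [mem_filter] at hB hC
  obtain ⟨i, hi, e1, e2⟩ := key B hB.1 hB.2
  obtain ⟨j, hj, f1, f2⟩ := key C hC.1 hC.2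
  rcases lt_trichotomy i j with h | h | h
  · rw [← e1, ← f1]
    exact hq i j (i + n) (j + n) h (by omega) (by omega) (by omega) (by rw [e1, e2]) (by rw [f1, f2])
  · rw [← e1, ← f1, h]
  · rw [← e1, ← f1]
    exact (hq j i (j + n) (i + n) h (by omega) (by omega) (by omega) (by rw [f1, f2])
      (by rw [e1, e2])).symm

theorem absMap_low {i : ℕ} (hi : i < n) :
    absMap (⟨i, by omega⟩ : Fin (2 * n)) = ⟨i, hi⟩ := by
  apply Fin.ext
  exact Nat.mod_eq_of_lt (by omega)

theorem absMap_high {i : ℕ} (hi : i < n) :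
    absMap (⟨i + n, by omega⟩ : Fin (2 * n)) = ⟨i, hi⟩ := by
  apply Fin.ext
  change (i + n) % n = i
  rw [Nat.add_mod_right, Nat.mod_eq_of_lt (by omega)]

theorem mem_image_absMap (B : Finset (Fin (2 * n))) (i : Fin n) :
    i ∈ B.image absMap ↔ (⟨i.1, by omega⟩ : Fin (2 * n)) ∈ B ∨
      (⟨i.1 + n, by omega⟩ : Fin (2 * n)) ∈ B := by
  rw [mem_image]
  constructor
  · rintro ⟨x, hx, rfl⟩
    obtain ⟨i, hi, rfl | rfl⟩ := negB_cases x
    · left; simpa only [absMap_low hi] using hx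
    · right; simpa only [absMap_high hi] using hx
  · rintro (h | h)
    · exact ⟨_, h, absMap_low i.2⟩
    · exact ⟨_, h, absMap_high i.2⟩

theorem absParts_iff (hs : NegSym n (lab σ)) (π : Finpartition (Finset.univ : Finset (Fin n))) :
    absParts σ = π.parts ↔ AbsRel n (lab π) (lab σ) := by
  have hl : ∀ i (hi : i < n), σ.part ⟨i, by omega⟩ = lab σ i := by
    intro i hi
    exact (lab_val _ _).symm
  have hh : ∀ i (hi : i < n), σ.part ⟨i + n, by omega⟩ = lab σ (i + n) := by
    intro i hi
    exact (lab_val _ _).symm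
  have hpi : ∀ i (hi : i < n), π.part ⟨i, hi⟩ = lab π i := by
    intro i hi
    exact (lab_val _ _).symm
  have hmem : ∀ i j (hi : i < n) (hj : j < n),
      (⟨j, hj⟩ : Fin n) ∈ (lab σ i).image absMap ↔ lab σ i = lab σ j ∨ lab σ i = lab σ (j + n) := by
    intro i j hi hj
    rw [mem_image_absMap, ← hl i hi, mem_part_iff, mem_part_iff, hl i hi, hl j hj, hh j hj,
      eq_comm, eq_comm (a := lab σ (j + n))]
  have hhigh : ∀ i, i < n → (lab σ (i + n)).image absMap = (lab σ i).image absMap := by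
    intro i hi
    ext ⟨j, hj⟩
    rw [hmem i j hi hj, mem_image_absMap, ← hh i hi, mem_part_iff, mem_part_iff, hh i hi, hl j hj,
      hh j hj]
    have h1 := hs i j hi hj
    have h2 := hs j i hj hi
    constructor
    · rintro (h | h)
      · right; exact (h2.2.2 h).symm
      · left; exact h1.2.1 h.symm
    · rintro (h | h)
      · right; exact (h1.1 h).symm
      · left; exact (h1.2.2 h).symm
  have habs : absParts σ = Finset.univ.image (fun i : Fin n => (lab σ i.1).image absMap) := by
    rw [absParts, parts_eq, image_image]
    ext B
    simp only [mem_image, mem_univ, true_and, Function.comp]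
    constructor
    · rintro ⟨x, rfl⟩
      obtain ⟨i, hi, rfl | rfl⟩ := negB_cases x
      · exact ⟨⟨i, hi⟩, by rw [hl i hi]⟩
      · exact ⟨⟨i, hi⟩, by rw [hh i hi, hhigh i hi]⟩
    · rintro ⟨⟨i, hi⟩, rfl⟩
      exact ⟨⟨i, by omega⟩, by rw [hl i hi]⟩
  constructor
  · intro h i j hi hj
    have hB : (lab σ i).image absMap ∈ π.parts := by
      rw [← h, habs]
      exact mem_image_of_mem _ (mem_univ (⟨i, hi⟩ : Fin n))
    have := π.part_eq_of_mem hB ((hmem i i hi hi).2 (Or.inl rfl))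
    rw [← hmem i j hi hj, ← this, mem_part_iff, hpi, hpi, eq_comm]
  · intro h
    rw [habs, parts_eq]
    congr 1
    funext ⟨i, hi⟩
    ext ⟨j, hj⟩
    rw [mem_part_iff, hmem i j hi hj, hpi, hpi, ← h i j hi hj, eq_comm]

end symm

theorem mem_NC_iff {n : ℕ} (π : Finpartition (Finset.univ : Finset (Fin n))) :
    π ∈ NC n ↔ NatNC n (lab π) := by
  rw [NC, mem_fil, isNoncrossing_iff]
  simp

theorem exists_abs {n : ℕ} (σ : Finpartition (Finset.univ : Finset (Fin (2 * n))))
    (h : σ ∈ NCB n) : ∃ π ∈ NC n, absParts σ = π.parts := by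
  rw [mem_NCB_iff] at h
  obtain ⟨hq, hs⟩ := h
  have ha : AbsRel n (lab (mkPart n fun i => s(lab σ i, lab σ (i + n)))) (lab σ) := by
    intro i j hi hj
    rw [lab_mkPart hi hj, Sym2.eq_iff]
    have h1 := hs i j hi hj
    constructor
    · rintro (h | h)
      · exact Or.inl h.1
      · exact Or.inr h.1
    · rintro (h | h)
      · exact Or.inl ⟨h, h1.1 h⟩
      · exact Or.inr ⟨h, h1.2.2 h⟩
  exact ⟨_, (mem_NC_iff _).2 (abs_nc hq hs ha), (absParts_iff σ hs _).2 ha⟩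

theorem fiber_card {n : ℕ} (π : Finpartition (Finset.univ : Finset (Fin n))) (hπ : π ∈ NC n) :
    (fil (NCB n) (fun σ => absParts σ = π.parts)).card = n + 1 := by
  rw [mem_NC_iff] at hπ
  have hlab : ∀ k, ∀ i j, i < 2 * n → j < 2 * n → (rlab n (lab π) k i = rlab n (lab π) k j ↔
      lab (mkPart (2 * n) (rlab n (lab π) k)) i = lab (mkPart (2 * n) (rlab n (lab π) k)) j) :=
    fun k i j hi hj => (lab_mkPart hi hj).symm
  rw [← Finset.card_range (n + 1)]
  symm
  refine Finset.card_bij (fun k _ => mkPart (2 * n) (rlab n (lab π) k)) ?_ ?_ ?_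
  · intro k hk
    have hk' : k ≤ n := by rw [mem_range] at hk; omega
    have hs := negSym_congr (hlab k) (rlab_sym hk')
    rw [mem_fil, mem_NCB_iff, absParts_iff _ hs]
    exact ⟨⟨natNC_congr (hlab k) (rlab_nc hk' hπ), hs⟩, absRel_congr (hlab k) rlab_abs⟩
  · intro k hk l hl e
    have hk' : k ≤ n := by rw [mem_range] at hk; omega
    have hl' : l ≤ n := by rw [mem_range] at hl; omega
    have h1 := charK_congr (hlab k) (rlab_char hk')
    have h2 := charK_congr (hlab l) (rlab_char hl')
    have e' : mkPart (2 * n) (rlab n (lab π) k) = mkPart (2 * n) (rlab n (lab π) l) := e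
    rw [e'] at h1
    exact charK_unique h1 h2
  · intro σ hσ
    rw [mem_fil, mem_NCB_iff] at hσ
    obtain ⟨⟨hq, hs⟩, ha⟩ := hσ
    rw [absParts_iff _ hs] at ha
    obtain ⟨k, hk⟩ := charK_exists n (lab σ)
    refine ⟨k, by rw [mem_range]; have := hk.1; omega, ?_⟩
    refine part_ext fun i j hi hj => ?_
    rw [← hlab k i j hi hj]
    exact (uniq_iff hq hs ha hk hi hj).symm

/-- **Biane–Goodman–Nica.** `Abs` maps `NC_B(n)` onto `NC(n)`, and every fiber has
exactly `n + 1` elements; in particular `#NC_B(n) = (n+1) #NC(n)`. -/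
theorem abs_is_n_plus_one_to_one (n : ℕ) (hn : 1 ≤ n) :
    (∀ σ ∈ NCB n, ∃ π ∈ NC n, absParts σ = π.parts) ∧
    (∀ π ∈ NC n, (fil (NCB n) (fun σ => absParts σ = π.parts)).card = n + 1) ∧
    (NCB n).card = (n + 1) * (NC n).card := by
  refine ⟨fun σ hσ => exists_abs σ hσ, fun π hπ => fiber_card π hπ, ?_⟩
  classical
  have hU : NCB n = (NC n).biUnion fun π => fil (NCB n) (fun σ => absParts σ = π.parts) := by
    ext σ
    simp only [mem_biUnion, mem_fil]
    constructor
    · intro h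
      obtain ⟨π, hπ, e⟩ := exists_abs σ h
      exact ⟨π, hπ, h, e⟩
    · rintro ⟨π, hπ, h, e⟩
      exact h
  rw [hU, Finset.card_biUnion, Finset.sum_congr rfl fun π hπ => fiber_card π hπ, Finset.sum_const,
    smul_eq_mul, mul_comm]
  intro π hπ τ hτ hne
  change Disjoint _ _
  rw [Finset.disjoint_left]
  intro σ h1 h2
  rw [mem_fil] at h1 h2
  exact hne (Finpartition.ext (h1.2.symm.trans h2.2))
end

section
/- For all integers n ≥ 1 and k ≥ 1, there is a bijection between NC_{k+1}(n) and NC^k(n); in particular #NC_{k+1}(n) = #NC^k(n). (The bijection is induced by identifying, in a (k+1)-equal non-crossing partition of {1,…,(k+1)n}, each pair of points {j(k+1), j(k+1)+1} for j = 1,…,n, taken modulo (k+1)n.) -/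
open Finset

/-- `NCdiv k n` : the set of `k`-divisible non-crossing partitions of `{1,…,kn}`
(all blocks have size divisible by `k`). -/
noncomputable def NCdiv (k n : ℕ) : Finset (Finpartition (Finset.univ : Finset (Fin (k * n)))) :=
  fil Finset.univ (fun π => IsNoncrossing π ∧ ∀ B ∈ π.parts, k ∣ B.card)

/-- `NCeq k n` : the set of `k`-equal non-crossing partitions of `{1,…,kn}`
(all blocks have size exactly `k`). -/
noncomputable def NCeq (k n : ℕ) : Finset (Finpartition (Finset.univ : Finset (Fin (k * n)))) :=
  fil Finset.univ (fun π => IsNoncrossing π ∧ ∀ B ∈ π.parts, B.card = k)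

/-- The number of blocks of `π` of size `i`. -/
def blockCount {n : ℕ} (π : Finpartition (Finset.univ : Finset (Fin n))) (i : ℕ) : ℕ :=
  (π.parts.filter (fun B => B.card = i)).card


/-! ### Words -/

/-- Lukasiewicz condition, recursively. -/
def okw : ℕ → List ℕ → Prop
  | h, [] => h = 0
  | h, (s :: l) => 1 ≤ h + s ∧ okw (h + s - 1) l

/-- expand -/
def gw (k : ℕ) : List ℕ → List ℕ
  | [] => []
  | (m :: l) => List.replicate m (k + 1) ++ 0 :: gw k l

theorem okw_iff (l : List ℕ) : ∀ h, okw h l ↔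
    (h + ∑ i ∈ range l.length, l.getD i 0 = l.length) ∧
      ∀ i < l.length, i + 1 ≤ h + ∑ j ∈ range (i + 1), l.getD j 0 := by
  induction l with
  | nil => intro h; simp [okw]
  | cons s l ih =>
    intro h
    simp only [okw, ih, List.length_cons, Finset.sum_range_succ', List.getD_cons_succ,
      List.getD_cons_zero]
    constructor
    · rintro ⟨h1, h2, h3⟩
      refine ⟨by omega, ?_⟩
      intro i hi
      rcases i with _ | i
      · simp; omega
      · have := h3 i (by omega)
        have e := Finset.sum_range_succ' (fun x => l.getD x 0) i
        omega
    · rintro ⟨h2, h3⟩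
      have h0 := h3 0 (by omega)
      simp at h0
      refine ⟨by omega, by omega, ?_⟩
      intro i hi
      have := h3 (i + 1) (by omega)
      rw [Finset.sum_range_succ'] at this
      have e := Finset.sum_range_succ' (fun x => l.getD x 0) i
      simp only [List.getD_cons_succ] at *
      omega

theorem okw_rep (k m : ℕ) (l : List ℕ) : ∀ h,
    okw h (List.replicate m (k + 1) ++ l) ↔ okw (h + k * m) l := by
  induction m with
  | zero => intro h; simp
  | succ m ih =>
    intro h
    simp only [List.replicate_succ, List.cons_append, okw, ih]
    have : h + (k + 1) - 1 + k * m = h + k * (m + 1) := by rw [Nat.mul_succ]; omega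
    rw [this]
    constructor
    · exact fun h => h.2
    · exact fun h => ⟨by omega, h⟩

theorem okw_gw (k : ℕ) (l : List ℕ) : ∀ h, okw h (gw k l) ↔ okw h (l.map (k * ·)) := by
  induction l with
  | nil => intro h; simp [gw]
  | cons m l ih =>
    intro h
    simp [gw, okw_rep, okw, ih]

theorem gw_mem (k : ℕ) (l : List ℕ) : ∀ x ∈ gw k l, x = 0 ∨ x = k + 1 := by
  induction l with
  | nil => simp [gw]
  | cons m l ih =>
    intro x hx
    simp only [gw, List.mem_append, List.mem_cons, List.mem_replicate] at hx
    rcases hx with h | h | h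
    · exact Or.inr h.2
    · exact Or.inl h
    · exact ih x h

theorem gw_length (k : ℕ) (l : List ℕ) : (gw k l).length = l.length + l.sum := by
  induction l with
  | nil => simp [gw]
  | cons m l ih => simp [gw, ih]; omega

theorem gw_inj (k : ℕ) (l : List ℕ) : ∀ l', gw k l = gw k l' → l = l' := by
  induction l with
  | nil =>
    intro l' h
    cases l' with
    | nil => rfl
    | cons a b => simp [gw] at h
  | cons m l ih =>
    intro l' h
    cases l' with
    | nil => simp [gw] at h
    | cons a b =>
      simp only [gw] at h
      induction m generalizing a with
      | zero =>
        cases a with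
        | zero => simp at h; rw [ih _ h]
        | succ a => simp [List.replicate_succ] at h
      | succ m ihm =>
        cases a with
        | zero => simp [List.replicate_succ] at h
        | succ a =>
          simp only [List.replicate_succ, List.cons_append, List.cons.injEq, true_and] at h
          have := ihm a h
          simp at this ⊢
          exact this

theorem gw_surj (k : ℕ) (hk : 1 ≤ k) (w : List ℕ) : ∀ h, okw h w → (∀ x ∈ w, x = 0 ∨ x = k + 1) →
    ∃ l, gw k l = w := by
  induction w with
  | nil => intro h _ _; exact ⟨[], rfl⟩
  | cons a w ih =>
    intro h h1 h2
    obtain ⟨l, hl⟩ := ih _ h1.2 (fun x hx => h2 x (List.mem_cons_of_mem _ hx))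
    rcases h2 a List.mem_cons_self with h | h
    · exact ⟨0 :: l, by simp [gw, hl, h]⟩
    · subst h
      cases l with
      | nil =>
        have := h1.2
        rw [← hl] at this
        simp [gw, okw] at this
        omega
      | cons m l =>
        refine ⟨(m + 1) :: l, ?_⟩
        rw [← hl]
        simp [gw, List.replicate_succ]

theorem okw_sum (l : List ℕ) : ∀ h, okw h l → h + l.sum = l.length := by
  induction l with
  | nil => intro h; simp [okw]
  | cons s l ih =>
    rintro h ⟨h1, h2⟩
    have := ih _ h2
    simp
    omega

theorem words_card (n k : ℕ) (hk : 1 ≤ k) :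
    Nat.card {l : List ℕ // l.length = k * n ∧ okw 0 l ∧ ∀ x ∈ l, x = 0 ∨ k ∣ x} =
    Nat.card {l : List ℕ // l.length = (k + 1) * n ∧ okw 0 l ∧ ∀ x ∈ l, x = 0 ∨ x = k + 1} := by
  have key : ∀ l : List ℕ, (∀ x ∈ l, x = 0 ∨ k ∣ x) → (l.map (· / k)).map (k * ·) = l := by
    intro l hl
    rw [List.map_map]
    conv_rhs => rw [← List.map_id l]
    apply List.map_congr_left
    intro x hx
    rcases hl x hx with h | h
    · simp [h]
    · simp [Nat.mul_div_cancel' h]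
  have ksum : ∀ l : List ℕ, (l.map (k * ·)).sum = k * l.sum := by
    intro l
    induction l with
    | nil => simp
    | cons a l ih => simp [ih, Nat.mul_add]
  apply Nat.card_eq_of_bijective (fun l => ⟨gw k (l.1.map (· / k)), by
    obtain ⟨l, h1, h2, h3⟩ := l
    refine ⟨?_, ?_, gw_mem _ _⟩
    · have e := okw_sum _ _ h2
      rw [← key l h3, ksum] at e
      simp only [List.length_map, h1, zero_add] at e
      have := Nat.eq_of_mul_eq_mul_left (by omega) e
      rw [gw_length]
      simp only [List.length_map, h1, this]
      ring
    · rw [okw_gw]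
      simp only [key l h3]
      exact h2⟩)
  constructor
  · rintro ⟨l, h1, h2, h3⟩ ⟨l', h1', h2', h3'⟩ h
    simp only [Subtype.mk.injEq] at h ⊢
    rw [← key l h3, ← key l' h3', gw_inj _ _ _ h]
  · rintro ⟨w, h1, h2, h3⟩
    obtain ⟨l, rfl⟩ := gw_surj k hk w _ h2 h3
    have hh : (l.map (k * ·)).map (· / k) = l := by
      rw [List.map_map]
      conv_rhs => rw [← List.map_id l]
      apply List.map_congr_left
      intro x hx
      simp [Nat.mul_div_cancel_left _ hk]
    rw [okw_gw] at h2
    refine ⟨⟨l.map (k * ·), ?_, h2, ?_⟩, ?_⟩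
    · have e := okw_sum _ _ h2
      rw [ksum] at e
      rw [gw_length] at h1
      simp only [List.length_map, zero_add] at e ⊢
      have : (k + 1) * l.sum = (k + 1) * n := by rw [← h1, ← e]; ring
      have := Nat.eq_of_mul_eq_mul_left (by omega) this
      rw [← e, this]
    · intro x hx
      simp only [List.mem_map] at hx
      obtain ⟨a, _, rfl⟩ := hx
      exact Or.inr (dvd_mul_right _ _)
    · simp only [Subtype.mk.injEq, hh]

/-! ### Greedy maps -/

/-- number of `c' < c` with `m c' = j`. -/
def cnt (m : ℕ → ℕ) (c j : ℕ) : ℕ := ((range c).filter (fun x => m x = j)).card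

def Good (m s : ℕ → ℕ) (c : ℕ) : Prop :=
  m c ≤ c ∧ cnt m c (m c) < s (m c) ∧ ∀ j, m c < j → j ≤ c → s j ≤ cnt m c j

theorem cnt_succ (m : ℕ → ℕ) (c j : ℕ) : cnt m (c + 1) j = cnt m c j + if m c = j then 1 else 0 := by
  unfold cnt
  rw [Finset.range_add_one, Finset.filter_insert]
  split_ifs <;> simp

theorem cnt_congr {m m' : ℕ → ℕ} {c : ℕ} (h : ∀ x < c, m x = m' x) (j : ℕ) :
    cnt m c j = cnt m' c j := by
  unfold cnt
  congr 1
  apply Finset.filter_congr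
  intro x hx
  rw [h x (by simpa using hx)]

theorem cnt_mono (m : ℕ → ℕ) {c d : ℕ} (h : c ≤ d) (j : ℕ) : cnt m c j ≤ cnt m d j := by
  unfold cnt
  apply Finset.card_le_card
  apply Finset.filter_subset_filter
  simpa using h

theorem good_unique {m m' s : ℕ → ℕ} {N : ℕ} (h : ∀ c < N, Good m s c) (h' : ∀ c < N, Good m' s c) :
    ∀ c < N, m c = m' c := by
  intro c
  induction c using Nat.strong_induction_on with
  | _ c ih =>
    intro hc
    have e := cnt_congr (m := m) (m' := m') (c := c) (fun x hx => ih x hx (by omega))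
    obtain ⟨a1, a2, a3⟩ := h c hc
    obtain ⟨b1, b2, b3⟩ := h' c hc
    rcases lt_trichotomy (m c) (m' c) with hlt | heq | hlt
    · have := a3 _ hlt b1
      rw [e] at this; omega
    · exact heq
    · have := b3 _ hlt a1
      rw [← e] at this; omega

theorem sum_cnt (m : ℕ → ℕ) (c d : ℕ) (h : ∀ x < c, m x < d) : ∑ j ∈ range d, cnt m c j = c := by
  unfold cnt
  have := Finset.card_eq_sum_card_fiberwise (s := range c) (t := range d) (f := m)
    (by intro x hx; simp at hx ⊢; exact h x hx)
  simpa using this.symm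

theorem good_exists (s : ℕ → ℕ) (N : ℕ) (hs : ∀ i < N, i + 1 ≤ ∑ j ∈ range (i + 1), s j) :
    ∃ m, ∀ c < N, Good m s c := by
  induction N with
  | zero => exact ⟨id, by simp⟩
  | succ N ih =>
    obtain ⟨m, hm⟩ := ih (fun i hi => hs i (by omega))
    have hex : ∃ j, j ≤ N ∧ cnt m N j < s j := by
      by_contra! hcon
      have h1 : ∑ j ∈ range (N + 1), s j ≤ ∑ j ∈ range (N + 1), cnt m N j :=
        Finset.sum_le_sum (fun j hj => hcon j (by simp at hj; omega))
      rw [sum_cnt m N (N + 1) (fun x hx => by have := (hm x hx).1; omega)] at h1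
      have := hs N (by omega)
      omega
    obtain ⟨j0, hj0, hj0'⟩ := hex
    classical
    let v := Nat.findGreatest (fun j => cnt m N j < s j) N
    have hv : cnt m N v < s v := Nat.findGreatest_spec (P := fun j => cnt m N j < s j) hj0 hj0'
    have hvN : v ≤ N := Nat.findGreatest_le N
    have hvm : ∀ j, v < j → j ≤ N → s j ≤ cnt m N j := by
      intro j h1 h2
      have := Nat.findGreatest_is_greatest (P := fun j => cnt m N j < s j) h1 h2
      omega
    refine ⟨Function.update m N v, ?_⟩
    intro c hc
    have e : ∀ j, cnt (Function.update m N v) c j = cnt m c j := by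
      apply cnt_congr
      intro x hx
      exact Function.update_of_ne (by omega) _ _
    rcases Nat.lt_succ_iff_lt_or_eq.mp hc with h | h
    · obtain ⟨a1, a2, a3⟩ := hm c h
      have e2 : Function.update m N v c = m c := Function.update_of_ne (by omega) _ _
      simp only [Good, e, e2]
      exact ⟨a1, a2, a3⟩
    · subst h
      simp only [Good, e, Function.update_self]
      exact ⟨hvN, hv, hvm⟩

theorem good_cnt_le {m s : ℕ → ℕ} {N : ℕ} (h : ∀ c < N, Good m s c) (j : ℕ) : cnt m N j ≤ s j := by
  induction N with
  | zero => simp [cnt]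
  | succ N ih =>
    rw [cnt_succ]
    have := ih (fun c hc => h c (by omega))
    have h2 := (h N (by omega)).2.1
    split_ifs with e
    · rw [e] at h2; omega
    · omega

theorem good_idem {m s : ℕ → ℕ} {N : ℕ} (h : ∀ c < N, Good m s c) (c : ℕ) (hc : c < N) :
    m (m c) = m c := by
  obtain ⟨a1, a2, a3⟩ := h c hc
  obtain ⟨b1, b2, b3⟩ := h (m c) (by omega)
  by_contra hne
  have h3 := b3 (m c) (by omega) le_rfl
  have h4 : cnt m (m c) (m c) = 0 := by
    unfold cnt
    rw [Finset.card_eq_zero, Finset.filter_eq_empty_iff]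
    intro x hx
    simp at hx
    have := (h x (by omega)).1
    omega
  omega

theorem cnt_lt_of {m : ℕ → ℕ} {c d N : ℕ} (h1 : c ≤ d) (h2 : d < N) : cnt m c (m d) < cnt m N (m d) := by
  have a := cnt_mono m (show d + 1 ≤ N by omega) (m d)
  have b := cnt_mono m h1 (m d)
  rw [cnt_succ] at a
  simp at a
  omega

theorem good_nc {m s : ℕ → ℕ} {N : ℕ} (h : ∀ c < N, Good m s c) (a b c d : ℕ) (hab : a < b)
    (hbc : b < c) (hcd : c < d) (hd : d < N) (hac : m a = m c) (hbd : m b = m d) : m a = m b := by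
  rcases lt_trichotomy (m a) (m b) with hlt | heq | hlt
  · have h1 := (h c (by omega)).2.2 (m b) (by omega) (by have := (h b (by omega)).1; omega)
    have h2 := cnt_lt_of (m := m) hcd.le hd
    have h3 := good_cnt_le h (m d)
    rw [hbd] at h1
    omega
  · exact heq
  · have h1 := (h b (by omega)).2.2 (m a) (by omega) (by have := (h a (by omega)).1; omega)
    have h2 := cnt_lt_of (m := m) hbc.le (show c < N by omega)
    have h3 := good_cnt_le h (m c)
    rw [hac] at h1
    omega

/-- Non-crossing min maps are greedy for their own counting function. -/
theorem nc_good {m : ℕ → ℕ} {N : ℕ} (hle : ∀ c < N, m c ≤ c) (hid : ∀ c < N, m (m c) = m c)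
    (hnc : ∀ a b c d, a < b → b < c → c < d → d < N → m a = m c → m b = m d → m a = m b) :
    ∀ c < N, Good m (cnt m N) c := by
  intro c hc
  refine ⟨hle c hc, cnt_lt_of le_rfl hc, ?_⟩
  intro j hj hjc
  by_contra! hlt
  -- there is `d ≥ c` with `m d = j`
  have : ∃ d, c ≤ d ∧ d < N ∧ m d = j := by
    by_contra! hcon
    have : cnt m N j ≤ cnt m c j := by
      unfold cnt
      apply Finset.card_le_card
      intro x hx
      simp at hx ⊢
      refine ⟨?_, hx.2⟩
      by_contra hh
      exact hcon x (by omega) hx.1 hx.2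
    omega
  obtain ⟨d, hd1, hd2, hd3⟩ := this
  have hdc : c ≠ d := by rintro rfl; omega
  have hjj : m j = j := by rw [← hd3]; exact hid d hd2
  have hjc' : j ≠ c := by rintro rfl; omega
  have := hnc (m c) j c d hj (by omega) (by omega) hd2 (hid c hc) (by rw [hjj, hd3])
  rw [hid c hc, hjj] at this
  omega

/-! ### Partitions -/

/-- block-minimum map -/
def mm {N : ℕ} (π : Finpartition (Finset.univ : Finset (Fin N))) (c : ℕ) : ℕ :=
  if h : c < N then ((π.part ⟨c, h⟩).min' ⟨_, π.mem_part (Finset.mem_univ _)⟩).val else c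

theorem mm_spec {N : ℕ} (π : Finpartition (Finset.univ : Finset (Fin N))) (c : Fin N) :
    ∃ e : Fin N, mm π c = e ∧ e ∈ π.part c ∧ ∀ d ∈ π.part c, e ≤ d := by
  refine ⟨(π.part c).min' ⟨_, π.mem_part (Finset.mem_univ _)⟩, ?_, Finset.min'_mem _ _, ?_⟩
  · simp [mm]
  · intro d hd
    exact Finset.min'_le _ _ hd

theorem mm_le {N : ℕ} (π : Finpartition (Finset.univ : Finset (Fin N))) (c : ℕ) : mm π c ≤ c := by
  by_cases h : c < N
  · obtain ⟨e, h1, h2, h3⟩ := mm_spec π ⟨c, h⟩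
    have := h3 _ (π.mem_part (Finset.mem_univ _))
    simp only at h1
    rw [h1]
    exact this
  · simp [mm, h]

theorem mm_eq_iff {N : ℕ} (π : Finpartition (Finset.univ : Finset (Fin N))) (c d : Fin N) :
    mm π c = mm π d ↔ d ∈ π.part c := by
  obtain ⟨e, h1, h2, h3⟩ := mm_spec π c
  obtain ⟨e', h1', h2', h3'⟩ := mm_spec π d
  constructor
  · intro h
    have : e = e' := Fin.ext (by omega)
    subst this
    have a := π.part_eq_of_mem (π.part_mem.2 (Finset.mem_univ c)) h2
    have b := π.part_eq_of_mem (π.part_mem.2 (Finset.mem_univ d)) h2'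
    rw [← a, b]
    exact π.mem_part (Finset.mem_univ _)
  · intro h
    have a := π.part_eq_of_mem (π.part_mem.2 (Finset.mem_univ c)) h
    rw [a] at h2' h3'
    rw [h1, h1']
    exact congrArg _ (le_antisymm (h3 _ h2') (h3' _ h2))

theorem mm_idem {N : ℕ} (π : Finpartition (Finset.univ : Finset (Fin N))) (c : ℕ) (hc : c < N) :
    mm π (mm π c) = mm π c := by
  obtain ⟨e, h1, h2, h3⟩ := mm_spec π ⟨c, hc⟩
  have := (mm_eq_iff π ⟨c, hc⟩ e).2 h2
  simp only at h1 this
  rw [h1] at this ⊢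
  exact this.symm

theorem cnt_mm {N : ℕ} (π : Finpartition (Finset.univ : Finset (Fin N))) (c : Fin N) :
    cnt (mm π) N (mm π c) = (π.part c).card := by
  unfold cnt
  rw [← Finset.card_map Fin.valEmbedding]
  congr 1
  ext x
  simp only [Finset.mem_filter, Finset.mem_range, Finset.mem_map, Fin.valEmbedding_apply]
  constructor
  · rintro ⟨h1, h2⟩
    exact ⟨⟨x, h1⟩, (mm_eq_iff π c ⟨x, h1⟩).1 h2.symm, rfl⟩
  · rintro ⟨d, h1, rfl⟩
    exact ⟨d.2, ((mm_eq_iff π c d).2 h1).symm⟩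

theorem mm_nc {N : ℕ} (π : Finpartition (Finset.univ : Finset (Fin N))) (h : IsNoncrossing π) :
    ∀ a b c d, a < b → b < c → c < d → d < N → mm π a = mm π c → mm π b = mm π d →
      mm π a = mm π b := by
  intro a b c d hab hbc hcd hd hac hbd
  have h1 := (mm_eq_iff π ⟨a, by omega⟩ ⟨c, by omega⟩).1 hac
  have h2 := (mm_eq_iff π ⟨b, by omega⟩ ⟨d, by omega⟩).1 hbd
  have := h ⟨a, by omega⟩ ⟨b, by omega⟩ ⟨c, by omega⟩ ⟨d, by omega⟩ hab hbc hcd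
    _ (π.part_mem.2 (Finset.mem_univ _)) _ (π.part_mem.2 (Finset.mem_univ _))
    (π.mem_part (Finset.mem_univ _)) h1 (π.mem_part (Finset.mem_univ _)) h2
  refine (mm_eq_iff π ⟨a, by omega⟩ ⟨b, by omega⟩).2 ?_
  rw [this]
  exact π.mem_part (Finset.mem_univ _)

theorem mm_inj {N : ℕ} (π π' : Finpartition (Finset.univ : Finset (Fin N)))
    (h : ∀ c < N, mm π c = mm π' c) : π = π' := by
  have hp : ∀ c : Fin N, π.part c = π'.part c := by
    intro c
    ext d
    rw [← mm_eq_iff, ← mm_eq_iff, h c c.2, h d d.2]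
  have key : ∀ (σ τ : Finpartition (Finset.univ : Finset (Fin N))),
      (∀ c : Fin N, σ.part c = τ.part c) → ∀ B ∈ σ.parts, B ∈ τ.parts := by
    intro σ τ hst B hB
    obtain ⟨x, hx⟩ := σ.nonempty_of_mem_parts hB
    rw [← σ.part_eq_of_mem hB hx, hst]
    exact τ.part_mem.2 (Finset.mem_univ _)
  apply Finpartition.ext
  ext B
  exact ⟨key _ _ hp B, key _ _ (fun c => (hp c).symm) B⟩

theorem nc_card (N : ℕ) (P : ℕ → Prop) :
    Nat.card {π : Finpartition (Finset.univ : Finset (Fin N)) //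
      IsNoncrossing π ∧ ∀ B ∈ π.parts, P B.card} =
    Nat.card {l : List ℕ // l.length = N ∧ okw 0 l ∧ ∀ x ∈ l, x = 0 ∨ P x} := by
  have getDmap : ∀ (f : ℕ → ℕ) (j : ℕ), j < N → ((List.range N).map f).getD j 0 = f j := by
    intro f j hj
    simp [List.getD, hj]
  apply Nat.card_eq_of_bijective (fun π => ⟨(List.range N).map (cnt (mm π.1) N), by
    obtain ⟨π, h1, h2⟩ := π
    refine ⟨by simp, ?_, ?_⟩
    · rw [okw_iff]
      have hsum : ∀ i ≤ N, ∑ j ∈ range i, ((List.range N).map (cnt (mm π) N)).getD j 0 =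
          ∑ j ∈ range i, cnt (mm π) N j := by
        intro i hi
        apply Finset.sum_congr rfl
        intro j hj
        exact getDmap _ _ (by simp at hj; omega)
      simp only [List.length_map, List.length_range, zero_add]
      constructor
      · rw [hsum N le_rfl, sum_cnt]
        intro x hx
        have := mm_le π x
        omega
      · intro i hi
        rw [hsum _ (by omega)]
        conv_lhs => rw [← sum_cnt (mm π) (i + 1) (i + 1)
          (by intro x hx; have := mm_le π x; omega)]
        exact Finset.sum_le_sum (fun j _ => cnt_mono _ (by omega) _)
    · intro x hx
      simp only [List.mem_map, List.mem_range] at hx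
      obtain ⟨j, hj, rfl⟩ := hx
      by_cases h0 : cnt (mm π) N j = 0
      · exact Or.inl h0
      · right
        unfold cnt at h0
        obtain ⟨c, hc⟩ := Finset.card_ne_zero.1 h0
        simp only [Finset.mem_filter, Finset.mem_range] at hc
        have := cnt_mm π ⟨c, hc.1⟩
        simp only [hc.2] at this
        rw [this]
        exact h2 _ (π.part_mem.2 (Finset.mem_univ _))⟩)
  constructor
  · rintro ⟨π, h1, h2⟩ ⟨π', h1', h2'⟩ h
    simp only [Subtype.mk.injEq] at h ⊢
    have hc : ∀ j < N, cnt (mm π) N j = cnt (mm π') N j := by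
      intro j hj
      rw [← getDmap (cnt (mm π) N) j hj, h, getDmap _ j hj]
    have g := nc_good (fun c _ => mm_le π c) (mm_idem π) (mm_nc π h1)
    have g' := nc_good (fun c _ => mm_le π' c) (mm_idem π') (mm_nc π' h1')
    apply mm_inj
    refine good_unique g (fun c hc' => ?_)
    obtain ⟨a1, a2, a3⟩ := g' c hc'
    refine ⟨a1, ?_, ?_⟩
    · rw [hc _ (by omega)]; exact a2
    · intro j hj hj'
      rw [hc _ (by omega)]; exact a3 j hj hj'
  · rintro ⟨l, hl, hok, hP⟩
    rw [okw_iff, hl] at hok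
    obtain ⟨hs, hpre⟩ := hok
    simp only [zero_add] at hs hpre
    obtain ⟨m, hm⟩ := good_exists (fun i => l.getD i 0) N hpre
    have hcnt : ∀ j < N, cnt m N j = l.getD j 0 := by
      have h1 : ∑ j ∈ range N, cnt m N j = ∑ j ∈ range N, l.getD j 0 := by
        rw [hs]
        exact sum_cnt _ _ _ (fun x hx => by have := (hm x hx).1; omega)
      rw [Finset.sum_eq_sum_iff_of_le (fun j _ => good_cnt_le hm j)] at h1
      intro j hj
      exact h1 j (by simpa using hj)
    classical
    let st : Setoid (Fin N) := Setoid.ker (fun c : Fin N => m c)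
    let π : Finpartition (Finset.univ : Finset (Fin N)) := Finpartition.ofSetoid st
    have hpart : ∀ c d : Fin N, d ∈ π.part c ↔ m c = m d := by
      intro c d
      rw [Finpartition.mem_part_ofSetoid_iff_rel]
      rfl
    have hmm : ∀ c < N, mm π c = m c := by
      intro c hc
      obtain ⟨e, h1, h2, h3⟩ := mm_spec π ⟨c, hc⟩
      simp only at h1
      rw [hpart] at h2
      simp only at h2
      have hlt : m c < N := by have := (hm c hc).1; omega
      have h4 := h3 ⟨m c, hlt⟩ (by rw [hpart]; exact (good_idem hm c hc).symm)
      have h5 : (e : ℕ) ≤ m c := h4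
      have h6 := (hm e e.2).1
      omega
    have hcm : ∀ j, cnt (mm π) N j = cnt m N j := cnt_congr hmm
    refine ⟨⟨π, ?_, ?_⟩, ?_⟩
    · intro a b c d hab hbc hcd B hB C hC ha hc hb hd
      have eB := π.part_eq_of_mem hB ha
      have eC := π.part_eq_of_mem hC hb
      rw [← eB, hpart] at hc
      rw [← eC, hpart] at hd
      have := good_nc hm a b c d hab hbc hcd d.2 hc hd
      rw [← hpart, eB] at this
      rw [← π.part_eq_of_mem hB this, eC]
    · intro B hB
      obtain ⟨c, hc⟩ := π.nonempty_of_mem_parts hB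
      have e := cnt_mm π c
      rw [π.part_eq_of_mem hB hc] at e
      have hlt : mm π c < N := by have := mm_le π c; omega
      rw [hcm, hcnt _ hlt] at e
      rw [← e]
      have hB0 : B.card ≠ 0 := Finset.card_ne_zero.2 ⟨c, hc⟩
      have hmem : l.getD (mm π c) 0 ∈ l := by
        rw [List.getD_eq_getElem _ _ (by omega)]
        exact List.getElem_mem _
      rcases hP _ hmem with h | h
      · omega
      · exact h
    · apply Subtype.ext
      apply List.ext_getElem
      · simp [hl]
      · intro i h1 h2
        simp only [List.getElem_map, List.getElem_range]
        rw [hcm, hcnt i (by simpa using h1), List.getD_eq_getElem _ _ h2]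

theorem fil_card {N : ℕ} (p : Finpartition (Finset.univ : Finset (Fin N)) → Prop) :
    (fil Finset.univ p).card = Nat.card {π // p π} := by
  classical
  rw [Nat.card_eq_fintype_card, Fintype.card_subtype]
  unfold fil
  congr

/-- There is a bijection between the `(k+1)`-equal non-crossing partitions of
`{1,…,(k+1)n}` and the `k`-divisible non-crossing partitions of `{1,…,kn}`;
in particular the two sets have the same cardinality. -/
theorem equal_equiv_divisible (n k : ℕ) (hn : 1 ≤ n) (hk : 1 ≤ k) :
    Nonempty (↥(NCeq (k + 1) n) ≃ ↥(NCdiv k n)) ∧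
    (NCeq (k + 1) n).card = (NCdiv k n).card := by

  have h : (NCeq (k + 1) n).card = (NCdiv k n).card := by
    unfold NCeq NCdiv
    rw [fil_card, fil_card, nc_card _ (fun x => x = k + 1), nc_card _ (fun x => k ∣ x),
      words_card n k hk]
  exact ⟨⟨Finset.equivOfCardEq h⟩, h⟩
end

section
/- Let n ≥ 2 and k ≥ 1 be integers. The number of partitions π in NC^k(n) such that 1 and 2 lie in the same block of π equals (k/(n−1))·binom((k+1)n − 2, n − 2); equivalently, (n−1) times that number equals k·binom((k+1)n − 2, n − 2). -/
open Finset

namespace CountAux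

/-! ### The opener function of a height function -/

/-- the position that opened the block of `i`. -/
def opn (H : ℕ → ℤ) (i : ℕ) : ℕ := Nat.findGreatest (fun j => H j ≤ H (i + 1)) i

lemma opn_le (H : ℕ → ℤ) (i : ℕ) : opn H i ≤ i := Nat.findGreatest_le i

lemma opn_spec {H : ℕ → ℤ} {i : ℕ} (h : H 0 ≤ H (i + 1)) : H (opn H i) ≤ H (i + 1) :=
  Nat.findGreatest_spec (P := fun j => H j ≤ H (i + 1)) (Nat.zero_le i) h

lemma opn_max {H : ℕ → ℤ} {i x : ℕ} (h1 : opn H i < x) (h2 : x ≤ i) : H (i + 1) < H x :=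
  not_le.1 (Nat.findGreatest_is_greatest (P := fun j => H j ≤ H (i + 1)) h1 h2)

lemma opn_unique {H : ℕ → ℤ} {i j : ℕ} (h0 : j ≤ i) (h1 : H j ≤ H (i + 1))
    (h2 : ∀ x, j < x → x ≤ i → H (i + 1) < H x) : opn H i = j := by
  apply le_antisymm
  · by_contra hlt
    push Not at hlt
    have h3 := h2 _ hlt (opn_le H i)
    have : H (opn H i) ≤ H (i + 1) :=
      Nat.findGreatest_spec (P := fun j => H j ≤ H (i + 1)) h0 h1
    omega
  · exact Nat.le_findGreatest h0 h1

lemma opn_idem {H : ℕ → ℤ} {i : ℕ} (h : H 0 ≤ H (i + 1)) : opn H (opn H i) = opn H i := by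
  rcases (opn_le H i).eq_or_lt with e | e
  · rw [e, e]
  · apply opn_unique le_rfl
    · have := opn_spec h
      have := opn_max (H := H) (i := i) (x := opn H i + 1) (by omega) (by omega)
      omega
    · intro x h1 h2; omega

lemma opn_noncross {H : ℕ → ℤ} {a b c d : ℕ} (hc0 : H 0 ≤ H (c + 1))
    (hd0 : H 0 ≤ H (d + 1)) (hab : a < b) (hbc : b < c)
    (hcd : c < d) (hac : opn H a = opn H c) (hbd : opn H b = opn H d) : opn H a = opn H b := by
  have la := opn_le H a
  have lb := opn_le H b
  rcases lt_trichotomy (opn H a) (opn H b) with h | h | h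
  · have h1 := opn_max (H := H) (i := c) (x := opn H b) (by omega) (by omega)
    have h2 := opn_max (H := H) (i := d) (x := c + 1) (by omega) (by omega)
    have h3 := opn_spec hd0
    rw [← hbd] at h3
    omega
  · exact h
  · have h1 := opn_max (H := H) (i := b) (x := opn H a) (by omega) (by omega)
    have h2 := opn_max (H := H) (i := c) (x := b + 1) (by omega) (by omega)
    have h3 := opn_spec hc0
    rw [← hac] at h3
    omega

lemma opn_fiber {H : ℕ → ℤ} {N : ℕ} (hstep : ∀ x, H x - 1 ≤ H (x + 1))
    (hpos : ∀ x ≤ N, H 0 ≤ H x) (hN : H N = H 0) {j : ℕ} (hj : j < N) :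
    (((range N).filter (fun i => opn H i = j)).card : ℤ) = H (j + 1) - H j + 1 := by
  have key : ((range N).filter (fun i => opn H i = j)).card = (Finset.Ico (H j) (H (j + 1) + 1)).card := by
    apply Finset.card_bij (fun i _ => H (i + 1))
    · intro i hi
      simp only [mem_filter, mem_range] at hi
      obtain ⟨hi, rfl⟩ := hi
      have h1 := opn_spec (hpos (i + 1) hi)
      rw [mem_Ico]
      refine ⟨h1, ?_⟩
      rcases (opn_le H i).eq_or_lt with e | e
      · rw [e]; omega
      · have := opn_max (H := H) (i := i) (x := opn H i + 1) (by omega) (by omega)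
        omega
    · have aux : ∀ i i', i < N → i' < N → opn H i = j → opn H i' = j → H (i + 1) = H (i' + 1) →
          ¬ i < i' := by
        intro i i' hi hi' e e' h hlt
        have := opn_le H i
        have := opn_max (H := H) (i := i') (x := i + 1) (by omega) (by omega)
        omega
      intro i hi i' hi' h
      simp only [mem_filter, mem_range] at hi hi'
      have h1 := aux i i' hi.1 hi'.1 hi.2 hi'.2 h
      have h2 := aux i' i hi'.1 hi.1 hi'.2 hi.2 h.symm
      omega
    · intro v hv
      rw [mem_Ico] at hv
      have hex : ∃ i, j ≤ i ∧ H (i + 1) ≤ v := by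
        refine ⟨N - 1, by omega, ?_⟩
        rw [show N - 1 + 1 = N by omega, hN]
        have := hpos j hj.le
        omega
      classical
      obtain ⟨h1, h2⟩ := Nat.find_spec hex
      have hmin : ∀ x, j ≤ x → x < Nat.find hex → v < H (x + 1) := by
        intro x hx hlt
        have := Nat.find_min hex hlt
        push Not at this
        exact this hx
      have hle : Nat.find hex ≤ N - 1 := Nat.find_min' hex (by
        refine ⟨by omega, ?_⟩
        rw [show N - 1 + 1 = N by omega, hN]
        have := hpos j hj.le
        omega)
      generalize Nat.find hex = i at *
      have hv2 : H (i + 1) = v := by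
        have hs := hstep i
        rcases h1.eq_or_lt with e | e
        · subst e; omega
        · have := hmin (i - 1) (by omega) (by omega)
          rw [show i - 1 + 1 = i by omega] at this
          omega
      refine ⟨i, ?_, hv2⟩
      simp only [mem_filter, mem_range]
      refine ⟨by omega, opn_unique h1 (by omega) ?_⟩
      intro x hx hxi
      have := hmin (x - 1) (by omega) (by omega)
      rw [show x - 1 + 1 = x by omega] at this
      omega
  rw [key, Int.card_Ico]
  have h1 := hstep j
  have := hpos j hj.le
  omega

/-! ### Partitions and codes -/

/-- minimum of the block of `i`. -/
def mn {N : ℕ} (π : Finpartition (Finset.univ : Finset (Fin N))) (i : Fin N) : Fin N :=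
  (π.part i).min' ⟨i, π.mem_part (mem_univ i)⟩

lemma mn_mem {N : ℕ} (π : Finpartition (Finset.univ : Finset (Fin N))) (i : Fin N) :
    mn π i ∈ π.part i := Finset.min'_mem _ _

lemma mn_le {N : ℕ} (π : Finpartition (Finset.univ : Finset (Fin N))) (i : Fin N) :
    mn π i ≤ i := Finset.min'_le _ _ (π.mem_part (mem_univ i))

lemma mn_eq_iff {N : ℕ} (π : Finpartition (Finset.univ : Finset (Fin N))) (i j : Fin N) :
    mn π i = mn π j ↔ π.part i = π.part j := by
  constructor
  · intro h
    have h1 := mn_mem π i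
    have h2 := mn_mem π j
    rw [π.mem_part_iff_part_eq_part (mem_univ _) (mem_univ _)] at h1 h2
    rw [← h1, ← h2, h]
  · intro h
    simp only [mn, h]

lemma mn_idem {N : ℕ} (π : Finpartition (Finset.univ : Finset (Fin N))) (i : Fin N) :
    mn π (mn π i) = mn π i := by
  rw [mn_eq_iff, ← π.mem_part_iff_part_eq_part (mem_univ _) (mem_univ _)]
  exact mn_mem π i

lemma ext_of_mn {N : ℕ} {π π' : Finpartition (Finset.univ : Finset (Fin N))}
    (h : mn π = mn π') : π = π' := by
  have hp : ∀ i, π.part i = π'.part i := by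
    intro i
    ext j
    rw [π.mem_part_iff_part_eq_part (mem_univ _) (mem_univ _),
      π'.mem_part_iff_part_eq_part (mem_univ _) (mem_univ _), ← mn_eq_iff, ← mn_eq_iff, h]
  have aux : ∀ (σ σ' : Finpartition (Finset.univ : Finset (Fin N))),
      (∀ i, σ.part i = σ'.part i) → ∀ B ∈ σ.parts, B ∈ σ'.parts := by
    intro σ σ' hs B hB
    obtain ⟨i, hi⟩ := σ.nonempty_of_mem_parts hB
    rw [← σ.part_eq_of_mem hB hi, hs i]
    exact σ'.part_mem.2 (mem_univ i)
  ext B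
  exact ⟨aux π π' hp B, aux π' π (fun i => (hp i).symm) B⟩

lemma noncross_mn {N : ℕ} (π : Finpartition (Finset.univ : Finset (Fin N))) :
    IsNoncrossing π ↔ ∀ a b c d : Fin N, a < b → b < c → c < d → mn π a = mn π c →
      mn π b = mn π d → mn π a = mn π b := by
  constructor
  · intro h a b c d hab hbc hcd hac hbd
    rw [mn_eq_iff] at *
    refine h a b c d hab hbc hcd _ (π.part_mem.2 (mem_univ a)) _ (π.part_mem.2 (mem_univ b))
      (π.mem_part (mem_univ _)) ?_ (π.mem_part (mem_univ _)) ?_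
    · rw [hac]; exact π.mem_part (mem_univ _)
    · rw [hbd]; exact π.mem_part (mem_univ _)
  · intro h a b c d hab hbc hcd B hB C hC ha hc hb hd
    have h1 := π.part_eq_of_mem hB ha
    have h2 := π.part_eq_of_mem hB hc
    have h3 := π.part_eq_of_mem hC hb
    have h4 := π.part_eq_of_mem hC hd
    have := h a b c d hab hbc hcd ((mn_eq_iff _ _ _).2 (h1.trans h2.symm))
      ((mn_eq_iff _ _ _).2 (h3.trans h4.symm))
    rw [mn_eq_iff, h1, h3] at this
    exact this

/-- the code of a partition. -/
def code {N : ℕ} (π : Finpartition (Finset.univ : Finset (Fin N))) (j : Fin N) : ℕ :=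
  (univ.filter (fun y => mn π y = j)).card

/-- extension by zero. -/
def extz {N : ℕ} (a : Fin N → ℕ) (j : ℕ) : ℕ := if h : j < N then a ⟨j, h⟩ else 0

/-- height function. -/
def hgt {N : ℕ} (a : Fin N → ℕ) (x : ℕ) : ℤ := ((∑ j ∈ range x, extz a j : ℕ) : ℤ) - x

/-- ballot sequences -/
def Ballot {N : ℕ} (a : Fin N → ℕ) : Prop := (∀ x ≤ N, 0 ≤ hgt a x) ∧ hgt a N = 0

lemma hgt_zero {N : ℕ} (a : Fin N → ℕ) : hgt a 0 = 0 := by simp [hgt]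

lemma hgt_succ {N : ℕ} (a : Fin N → ℕ) (x : ℕ) : hgt a (x + 1) = hgt a x + extz a x - 1 := by
  simp only [hgt, sum_range_succ]
  push_cast
  ring

lemma hgt_code {N : ℕ} (π : Finpartition (Finset.univ : Finset (Fin N))) {x : ℕ} (hx : x ≤ N) :
    hgt (code π) x = ((univ.filter (fun y : Fin N => x ≤ y.1 ∧ (mn π y).1 < x)).card : ℤ) := by
  have h1 : ∑ j ∈ range x, extz (code π) j =
      (univ.filter (fun y : Fin N => (mn π y).1 < x)).card := by
    rw [Finset.card_eq_sum_card_fiberwise (f := fun y => (mn π y).1) (t := range x)]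
    · apply sum_congr rfl
      intro j hj
      rw [mem_range] at hj
      rw [extz, dif_pos (by omega), code]
      congr 1
      ext y
      simp only [mem_filter, mem_univ, true_and, Fin.ext_iff]
      omega
    · intro y hy
      simpa using hy
  have h2 : (univ.filter (fun y : Fin N => (mn π y).1 < x)).card =
      (univ.filter (fun y : Fin N => y.1 < x)).card +
      (univ.filter (fun y : Fin N => x ≤ y.1 ∧ (mn π y).1 < x)).card := by
    rw [← card_union_of_disjoint]
    · congr 1
      ext y
      have := mn_le π y
      rw [Fin.le_def] at this
      simp only [mem_filter, mem_univ, true_and, mem_union]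
      omega
    · rw [disjoint_left]
      intro y hy hy'
      simp only [mem_filter, mem_univ, true_and] at hy hy'
      omega
  have h3 : (univ.filter (fun y : Fin N => y.1 < x)).card = x := by
    rw [Fin.card_filter_val_lt]; omega
  rw [hgt, h1, h2, h3]
  push_cast
  ring

lemma ballot_code {N : ℕ} (π : Finpartition (Finset.univ : Finset (Fin N))) :
    Ballot (code π) := by
  refine ⟨fun x hx => ?_, ?_⟩
  · rw [hgt_code π hx]; positivity
  · rw [hgt_code π le_rfl]
    simp only [Nat.cast_eq_zero, card_eq_zero, filter_eq_empty_iff]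
    intro y _
    omega

lemma mn_eq_opn {N : ℕ} {π : Finpartition (Finset.univ : Finset (Fin N))} (h : IsNoncrossing π)
    (i : Fin N) : (mn π i).1 = opn (hgt (code π)) i.1 := by
  rw [noncross_mn] at h
  symm
  have hle := mn_le π i
  rw [Fin.le_def] at hle
  apply opn_unique hle
  · rw [hgt_code π (by omega), hgt_code π (by omega)]
    norm_cast
    apply card_le_card
    intro y hy
    simp only [mem_filter, mem_univ, true_and] at hy ⊢
    have hne : y ≠ mn π i := by
      rintro rfl
      rw [mn_idem] at hy; omega
    have hne1 : y.1 ≠ (mn π i).1 := fun e => hne (Fin.ext e)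
    have hne2 : y.1 ≠ i.1 := by
      intro e
      have e := Fin.ext e
      subst e
      omega
    by_contra hcon
    have := h (mn π y) (mn π i) y i (by rw [Fin.lt_def]; omega) (by rw [Fin.lt_def]; omega)
      (by rw [Fin.lt_def]; omega) (mn_idem _ _) (mn_idem _ _)
    rw [mn_idem, mn_idem] at this
    rw [this] at hy
    omega
  · intro x hx hxi
    rw [hgt_code π (by omega), hgt_code π (by omega)]
    norm_cast
    apply card_lt_card
    rw [ssubset_iff_of_subset]
    · refine ⟨i, ?_, ?_⟩
      · simp only [mem_filter, mem_univ, true_and]; omega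
      · simp only [mem_filter, mem_univ, true_and]; omega
    · intro y hy
      simp only [mem_filter, mem_univ, true_and] at hy ⊢
      refine ⟨by omega, ?_⟩
      by_contra hcon
      have hne : mn π y ≠ i := by
        intro e
        have := mn_idem π y
        rw [e] at this
        rw [this] at hx
        omega
      have hne1 : (mn π y).1 ≠ i.1 := fun e => hne (Fin.ext e)
      have := h (mn π i) (mn π y) i y (by rw [Fin.lt_def]; omega) (by rw [Fin.lt_def]; omega)
        (by rw [Fin.lt_def]; omega) (mn_idem _ _) (mn_idem _ _)
      rw [mn_idem, mn_idem] at this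
      rw [← this] at hcon
      omega

lemma code_inj {N : ℕ} {π π' : Finpartition (Finset.univ : Finset (Fin N))} (h : IsNoncrossing π)
    (h' : IsNoncrossing π') (e : code π = code π') : π = π' := by
  apply ext_of_mn
  funext i
  apply Fin.ext
  rw [mn_eq_opn h, mn_eq_opn h', e]

lemma code_surj {N : ℕ} {a : Fin N → ℕ} (ha : Ballot a) :
    ∃ π : Finpartition (Finset.univ : Finset (Fin N)), IsNoncrossing π ∧ code π = a := by
  classical
  have h0 := hgt_zero a
  have hpos : ∀ x ≤ N, hgt a 0 ≤ hgt a x := fun x hx => by rw [h0]; exact ha.1 x hx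
  let f : Fin N → Fin N := fun i => ⟨opn (hgt a) i.1, (opn_le _ _).trans_lt i.2⟩
  let π : Finpartition (Finset.univ : Finset (Fin N)) := Finpartition.ofSetoid (Setoid.ker f)
  have hmem : ∀ i j, j ∈ π.part i ↔ f i = f j := fun i j => by
    rw [Finpartition.mem_part_ofSetoid_iff_rel]; rfl
  have hfi : ∀ i, f (f i) = f i := fun i => Fin.ext (opn_idem (hpos _ i.2))
  have hmn : ∀ i, mn π i = f i := by
    intro i
    apply le_antisymm
    · apply Finset.min'_le
      rw [hmem, hfi]
    · have h1 := mn_mem π i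
      rw [hmem] at h1
      rw [h1]
      exact opn_le _ _
  refine ⟨π, ?_, ?_⟩
  · rw [noncross_mn]
    intro x b c d hab hbc hcd hac hbd
    simp only [hmn] at *
    apply Fin.ext
    exact opn_noncross (hpos _ c.2) (hpos _ d.2) hab hbc hcd (Fin.ext_iff.1 hac) (Fin.ext_iff.1 hbd)
  · funext j
    have h1 := opn_fiber (H := hgt a) (N := N) (fun x => by rw [hgt_succ]; omega) hpos
      (by rw [h0]; exact ha.2) j.2
    rw [hgt_succ, extz, dif_pos j.2] at h1
    have h2 : code π j = ((range N).filter (fun i => opn (hgt a) i = j.1)).card := by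
      rw [code]
      apply Finset.card_bij (fun i _ => i.1)
      · intro i hi
        simp only [mem_filter, mem_univ, true_and, hmn, mem_range] at hi ⊢
        exact ⟨i.2, Fin.ext_iff.1 hi⟩
      · intro i _ i' _ e
        exact Fin.ext e
      · intro i hi
        simp only [mem_filter, mem_range] at hi
        refine ⟨⟨i, hi.1⟩, ?_, rfl⟩
        simp only [mem_filter, mem_univ, true_and, hmn]
        exact Fin.ext hi.2
    rw [← h2] at h1
    simp only [Fin.eta] at h1
    omega

lemma code_dvd {N : ℕ} (k : ℕ) (π : Finpartition (Finset.univ : Finset (Fin N))) :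
    (∀ B ∈ π.parts, k ∣ B.card) ↔ ∀ j, k ∣ code π j := by
  have key : ∀ i, code π (mn π i) = (π.part i).card := by
    intro i
    rw [code]
    congr 1
    ext y
    rw [mem_filter, mn_eq_iff, π.mem_part_iff_part_eq_part (mem_univ _) (mem_univ _)]
    simp
  constructor
  · intro h j
    by_cases hj : mn π j = j
    · rw [← hj, key]
      exact h _ (π.part_mem.2 (mem_univ _))
    · have : code π j = 0 := by
        rw [code, card_eq_zero, filter_eq_empty_iff]
        intro y _ e
        apply hj
        rw [← e, mn_idem]
      rw [this]
      exact dvd_zero k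
  · intro h B hB
    obtain ⟨i, hi⟩ := π.nonempty_of_mem_parts hB
    rw [← π.part_eq_of_mem hB hi, ← key]
    exact h _

lemma code_one {N : ℕ} (h0 : 0 < N) (h1 : 1 < N)
    (π : Finpartition (Finset.univ : Finset (Fin N))) :
    (∃ B ∈ π.parts, (⟨0, h0⟩ : Fin N) ∈ B ∧ (⟨1, h1⟩ : Fin N) ∈ B) ↔ code π ⟨1, h1⟩ = 0 := by
  have hz : mn π ⟨0, h0⟩ = ⟨0, h0⟩ := by
    have := mn_le π ⟨0, h0⟩
    rw [Fin.le_def] at this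
    apply Fin.ext
    simpa using this
  rw [← π.mem_part_iff_exists, π.mem_part_iff_part_eq_part (mem_univ _) (mem_univ _),
    ← mn_eq_iff, hz, code, card_eq_zero, filter_eq_empty_iff]
  constructor
  · intro h y _ e
    have := mn_idem π y
    rw [e, ← h] at this
    simp at this
  · intro h
    have h2 := h (mem_univ ⟨1, h1⟩)
    have h3 := mn_le π ⟨1, h1⟩
    rw [Fin.le_def] at h3
    have h4 : (mn π ⟨1, h1⟩).1 ≠ 1 := fun e => h2 (Fin.ext e)
    apply Fin.ext
    simp only at h3 ⊢
    omega

/-! ### The cycle lemma -/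

/-- periodic extension -/
def per {L : ℕ} (hL : 0 < L) (b : Fin L → ℕ) (j : ℕ) : ℕ := b ⟨j % L, Nat.mod_lt _ hL⟩

/-- cyclic shift -/
def shift {L : ℕ} (hL : 0 < L) (r : ℕ) (b : Fin L → ℕ) : Fin L → ℕ := fun i => per hL b (i.1 + r)

/-- partial sums -/
def psum {L : ℕ} (hL : 0 < L) (b : Fin L → ℕ) (x : ℕ) : ℕ := ∑ j ∈ range x, per hL b j

/-- all partial sums positive -/
def Good {L : ℕ} (hL : 0 < L) (k : ℕ) (b : Fin L → ℕ) : Prop :=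
  ∀ x, 1 ≤ x → x ≤ L → x < k * psum hL b x

lemma per_shift {L : ℕ} (hL : 0 < L) (r : ℕ) (b : Fin L → ℕ) (j : ℕ) :
    per hL (shift hL r b) j = per hL b (j + r) := by
  simp only [per, shift, Nat.mod_add_mod]

lemma shift_shift {L : ℕ} (hL : 0 < L) (r s : ℕ) (h : s + r = L) (b : Fin L → ℕ) :
    shift hL s (shift hL r b) = b := by
  funext i
  rw [shift, per_shift, per]
  congr 1
  apply Fin.ext
  simp only
  rw [add_assoc, h, Nat.add_mod_right, Nat.mod_eq_of_lt i.2]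

lemma psum_L {L : ℕ} (hL : 0 < L) (b : Fin L → ℕ) : psum hL b L = ∑ i, b i := by
  rw [psum, Finset.sum_range]
  apply sum_congr rfl
  intro i _
  rw [per]
  congr 1
  apply Fin.ext
  exact Nat.mod_eq_of_lt i.2

lemma psum_add_L {L : ℕ} (hL : 0 < L) (b : Fin L → ℕ) (x : ℕ) :
    psum hL b (x + L) = psum hL b x + ∑ i, b i := by
  induction x with
  | zero =>
    rw [Nat.zero_add, psum_L]
    simp [psum]
  | succ x ih =>
    have e : per hL b (x + L) = per hL b x := by simp [per]
    rw [show x + 1 + L = (x + L) + 1 by omega, psum, sum_range_succ, ← psum, ih, e]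
    rw [psum, psum, sum_range_succ]
    omega

lemma psum_shift {L : ℕ} (hL : 0 < L) (b : Fin L → ℕ) (r x : ℕ) :
    psum hL b (r + x) = psum hL b r + psum hL (shift hL r b) x := by
  simp only [psum, per_shift]
  rw [sum_range_add]
  simp only [add_comm]

lemma sum_shift {L : ℕ} (hL : 0 < L) (b : Fin L → ℕ) (r : ℕ) :
    ∑ i, shift hL r b i = ∑ i, b i := by
  have h1 := psum_shift hL b r L
  rw [psum_add_L, psum_L] at h1
  omega

lemma cycle_unique {L k n : ℕ} (hL : 0 < L) (hkn : k * n = L + 1) (b : Fin L → ℕ)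
    (hb : ∑ i, b i = n) : ∃! r, r < L ∧ Good hL k (shift hL r b) := by
  -- potential
  obtain ⟨s, hs⟩ : ∃ s : ℕ → ℤ, ∀ x, s x = (k : ℤ) * psum hL b x - x := ⟨_, fun _ => rfl⟩
  have hper : ∀ x, s (x + L) = s x + 1 := by
    intro x
    rw [hs, hs, psum_add_L, hb]
    push_cast
    have : (k : ℤ) * n = L + 1 := by exact_mod_cast hkn
    linear_combination this
  have hgood : ∀ r, Good hL k (shift hL r b) ↔ ∀ x, 1 ≤ x → x ≤ L → s r < s (r + x) := by
    intro r
    unfold Good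
    refine forall_congr' fun x => forall_congr' fun _ => forall_congr' fun _ => ?_
    rw [hs, hs, psum_shift]
    push_cast
    rw [mul_add]
    zify
    constructor <;> intro h <;> linarith
  simp only [hgood]
  obtain ⟨r0, hr0, hmin⟩ := Finset.exists_min_image (range L) s ⟨0, by simpa using hL⟩
  have hne : ((range L).filter (fun r => s r = s r0)).Nonempty := ⟨r0, by simpa using hr0⟩
  have hm := Finset.max'_mem _ hne
  have hlast : ∀ y ∈ (range L).filter (fun r => s r = s r0), y ≤ Finset.max' _ hne :=
    fun y hy => Finset.le_max' _ y hy
  generalize Finset.max' _ hne = r at hm hlast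
  simp only [mem_filter, mem_range] at hm hlast hmin
  have hr : ∀ x, 1 ≤ x → x ≤ L → s r < s (r + x) := by
    intro x h1 h2
    by_cases hx : r + x < L
    · have h3 := hmin _ hx
      rcases h3.eq_or_lt with e | e
      · have := hlast (r + x) ⟨hx, e.symm⟩
        omega
      · rw [hm.2]; exact e
    · have h3 := hper (r + x - L)
      rw [show r + x - L + L = r + x by omega] at h3
      have h4 := hmin (r + x - L) (by omega)
      omega
  refine ⟨r, ⟨hm.1, hr⟩, ?_⟩
  · intro r' hr'
    have aux : ∀ u v, v < L → (∀ x, 1 ≤ x → x ≤ L → s u < s (u + x)) →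
        (∀ x, 1 ≤ x → x ≤ L → s v < s (v + x)) → ¬ u < v := by
      intro u v hv h1 h2 huv
      have h3 := h1 (v - u) (by omega) (by omega)
      have h4 := h2 (L - (v - u)) (by omega) (by omega)
      rw [show u + (v - u) = v by omega] at h3
      rw [show v + (L - (v - u)) = u + L by omega, hper] at h4
      omega
    have h1 := aux r r' hr'.1 hr hr'.2
    have h2 := aux r' r hm.1 hr'.2 hr
    omega

open Classical in
lemma card_good {L k n : ℕ} (hL : 0 < L) (hkn : k * n = L + 1) :
    L * ((piAntidiag (univ : Finset (Fin L)) n).filter (Good hL k)).card =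
      (L + n - 1).choose n := by
  have hcard : (piAntidiag (univ : Finset (Fin L)) n).card = (L + n - 1).choose n := by
    rw [← map_sym_eq_piAntidiag, card_map, sym_univ, card_univ, Sym.card_sym_eq_choose,
      Fintype.card_fin]
  rw [← hcard]
  have h1 : (piAntidiag (univ : Finset (Fin L)) n).card =
      ∑ b ∈ piAntidiag (univ : Finset (Fin L)) n,
        ((range L).filter (fun r => Good hL k (shift hL r b))).card := by
    rw [card_eq_sum_ones]
    apply sum_congr rfl
    intro b hb
    rw [mem_piAntidiag] at hb
    obtain ⟨r, hr, hu⟩ := cycle_unique hL hkn b hb.1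
    symm
    rw [card_eq_one]
    refine ⟨r, ?_⟩
    ext r'
    simp only [mem_filter, mem_range, mem_singleton]
    constructor
    · exact hu r'
    · rintro rfl; exact hr
  rw [h1]
  have h2 := Finset.sum_card_bipartiteAbove_eq_sum_card_bipartiteBelow
    (s := piAntidiag (univ : Finset (Fin L)) n) (t := range L)
    (fun b r => Good hL k (shift hL r b))
  simp only [bipartiteAbove, bipartiteBelow] at h2
  rw [h2]
  rw [Finset.sum_const_nat (m := ((piAntidiag (univ : Finset (Fin L)) n).filter (Good hL k)).card)]
  · simp
  · intro r hr
    rw [mem_range] at hr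
    apply Finset.card_bij (fun b _ => shift hL r b)
    · intro b hb
      simp only [mem_filter, mem_piAntidiag, sum_shift, mem_univ, implies_true, and_true] at hb ⊢
      exact hb
    · intro b _ b' _ e
      rw [← shift_shift hL r (L - r) (by omega) b, e, shift_shift hL r (L - r) (by omega) b']
    · intro b hb
      have e := shift_shift hL (L - r) r (by omega) b
      refine ⟨shift hL (L - r) b, ?_, e⟩
      simp only [mem_filter, mem_piAntidiag, sum_shift, mem_univ, implies_true, and_true, e] at hb ⊢
      exact hb

/-! ### Deleting the second entry of a code -/

/-- `b` is obtained from `a` by deleting the second entry, zero, and dividing by `k`. -/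
def Rel {N L : ℕ} (hL : 0 < L) (k : ℕ) (a : Fin N → ℕ) (b : Fin L → ℕ) : Prop :=
  extz a 0 = k * per hL b 0 ∧ extz a 1 = 0 ∧
    ∀ i, 1 ≤ i → i < L → extz a (i + 1) = k * per hL b i

lemma rel_sum {N L : ℕ} {hL : 0 < L} {k : ℕ} {a : Fin N → ℕ} {b : Fin L → ℕ}
    (h : Rel hL k a b) {x : ℕ} (h1 : 1 ≤ x) (h2 : x ≤ L) :
    ∑ j ∈ range (x + 1), extz a j = k * psum hL b x := by
  induction x, h1 using Nat.le_induction with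
  | base => simp [sum_range_succ, psum, h.1, h.2.1]
  | succ x hx ih =>
    rw [sum_range_succ, ih (by omega), h.2.2 x hx (by omega)]
    simp only [psum, sum_range_succ]
    ring

lemma rel_ballot {N L n : ℕ} {hL : 0 < L} {k : ℕ} (hk : 1 ≤ k) (hN : N = L + 1) (hkn : k * n = N)
    {a : Fin N → ℕ} {b : Fin L → ℕ} (h : Rel hL k a b) :
    Ballot a ↔ ∑ i, b i = n ∧ Good hL k b := by
  have hg : ∀ x, 1 ≤ x → x ≤ L → hgt a (x + 1) = ((k * psum hL b x : ℕ) : ℤ) - (x + 1) := by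
    intro x h1 h2
    rw [hgt, rel_sum h h1 h2]
    push_cast
    ring
  have hLL := hg L (by omega) le_rfl
  rw [← hN, psum_L] at hLL
  constructor
  · rintro ⟨h1, h2⟩
    refine ⟨?_, ?_⟩
    · rw [h2] at hLL
      have : k * ∑ i, b i = k * n := by omega
      exact Nat.eq_of_mul_eq_mul_left (by omega) this
    · intro x hx1 hx2
      have h3 := h1 (x + 1) (by omega)
      rw [hg x hx1 hx2] at h3
      omega
  · rintro ⟨h1, h2⟩
    refine ⟨?_, ?_⟩
    · intro x hx
      rcases x with _ | _ | x
      · rw [hgt_zero]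
      · rw [hgt_succ, hgt_zero, h.1]
        have h3 := h2 1 le_rfl (by omega)
        rw [psum, sum_range_one] at h3
        omega
      · rw [hg (x + 1) (by omega) (by omega)]
        have h3 := h2 (x + 1) (by omega) (by omega)
        omega
    · rw [hLL, h1, hkn, hN]
      push_cast
      ring

lemma rel_right {N L : ℕ} {hL : 0 < L} {k : ℕ} (hk : 1 ≤ k)
    {a : Fin N → ℕ} {b b' : Fin L → ℕ} (h : Rel hL k a b) (h' : Rel hL k a b') : b = b' := by
  have key : ∀ i, i < L → per hL b i = per hL b' i := by
    intro i hi
    rcases Nat.eq_zero_or_pos i with rfl | hp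
    · exact Nat.eq_of_mul_eq_mul_left (by omega) (h.1.symm.trans h'.1)
    · exact Nat.eq_of_mul_eq_mul_left (by omega) ((h.2.2 i hp hi).symm.trans (h'.2.2 i hp hi))
  funext i
  have h1 := key i.1 i.2
  simpa only [per, Nat.mod_eq_of_lt i.2] using h1

lemma rel_left {N L : ℕ} {hL : 0 < L} {k : ℕ} (hN : N = L + 1)
    {a a' : Fin N → ℕ} {b : Fin L → ℕ} (h : Rel hL k a b) (h' : Rel hL k a' b) : a = a' := by
  have key : ∀ i, i < N → extz a i = extz a' i := by
    intro i hi
    rcases i with _ | _ | i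
    · rw [h.1, h'.1]
    · rw [h.2.1, h'.2.1]
    · rw [h.2.2 (i + 1) (by omega) (by omega), h'.2.2 (i + 1) (by omega) (by omega)]
  funext i
  have h1 := key i.1 i.2
  simpa only [extz, dif_pos i.2] using h1

lemma rel_exists_left {N L : ℕ} (hL : 0 < L) (k : ℕ) (hN : N = L + 1) (b : Fin L → ℕ) :
    ∃ a : Fin N → ℕ, Rel hL k a b ∧ ∀ j, k ∣ a j := by
  refine ⟨fun i => if i.1 = 0 then k * per hL b 0 else if i.1 = 1 then 0
    else k * per hL b (i.1 - 1), ⟨?_, ?_, ?_⟩, ?_⟩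
  · rw [extz, dif_pos (by omega)]; simp
  · rw [extz, dif_pos (by omega)]; simp
  · intro i h1 h2
    rw [extz, dif_pos (by omega)]
    simp only
    rw [if_neg (by omega), if_neg (by omega), Nat.add_sub_cancel]
  · intro j
    simp only
    split_ifs
    · exact dvd_mul_right _ _
    · exact dvd_zero _
    · exact dvd_mul_right _ _

/-- delete the second entry and divide by `k`. -/
def toB {N : ℕ} (L k : ℕ) (a : Fin N → ℕ) : Fin L → ℕ :=
  fun i => extz a (if i.1 = 0 then 0 else i.1 + 1) / k

lemma rel_toB {N L : ℕ} (hL : 0 < L) (k : ℕ) {a : Fin N → ℕ}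
    (h1 : extz a 1 = 0) (hd : ∀ j, k ∣ a j) : Rel hL k a (toB L k a) := by
  have hd' : ∀ j, k ∣ extz a j := by
    intro j
    rw [extz]
    split_ifs
    · exact hd _
    · exact dvd_zero _
  refine ⟨?_, h1, ?_⟩
  · simp only [per, toB, Nat.zero_mod, if_true]
    rw [Nat.mul_div_cancel' (hd' _)]
  · intro i hi1 hi2
    simp only [per, toB, Nat.mod_eq_of_lt hi2]
    rw [if_neg (by omega), Nat.mul_div_cancel' (hd' _)]

open Classical in
lemma card_partitions {N L n k : ℕ} (hL : 0 < L) (hk : 1 ≤ k) (hN : N = L + 1) (hkn : k * n = N)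
    (S : Finset (Finpartition (Finset.univ : Finset (Fin N))))
    (hS : ∀ π, π ∈ S ↔ (IsNoncrossing π ∧ ∀ j, k ∣ code π j) ∧ extz (code π) 1 = 0) :
    S.card = ((piAntidiag (univ : Finset (Fin L)) n).filter (Good hL k)).card := by
  have hR : ∀ π ∈ S, Rel hL k (code π) (toB L k (code π)) := by
    intro π hπ
    rw [hS] at hπ
    exact rel_toB hL k hπ.2 hπ.1.2
  apply Finset.card_bij (fun π _ => toB L k (code π))
  · intro π hπ
    have := (rel_ballot hk hN hkn (hR π hπ)).1 (ballot_code π)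
    simp only [mem_filter, mem_piAntidiag, mem_univ, implies_true, and_true]
    exact this
  · intro π hπ π' hπ' e
    have h1 := hR π hπ
    have h2 := hR π' hπ'
    rw [e] at h1
    exact code_inj ((hS π).1 hπ).1.1 ((hS π').1 hπ').1.1 (rel_left hN h1 h2)
  · intro b hb
    simp only [mem_filter, mem_piAntidiag, mem_univ, implies_true, and_true] at hb
    obtain ⟨a, ha, hd⟩ := rel_exists_left hL k hN b
    obtain ⟨π, hπ, rfl⟩ := code_surj ((rel_ballot hk hN hkn ha).2 hb)
    have hm : π ∈ S := (hS π).2 ⟨⟨hπ, hd⟩, ha.2.1⟩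
    exact ⟨π, hm, rel_right hk (hR π hm) ha⟩

lemma mem_fil {α : Type*} (s : Finset α) (p : α → Prop) (x : α) :
    x ∈ fil s p ↔ x ∈ s ∧ p x := by
  simp [fil]

lemma choose_arith {n k L c : ℕ} (hn : 2 ≤ n) (hk : k * n = L + 1) (hL : 0 < L)
    (h : L * c = (L + n - 1).choose n) : (n - 1) * c = k * (L + n - 1).choose (n - 2) := by
  obtain ⟨m, rfl⟩ : ∃ m, n = m + 2 := ⟨n - 2, by omega⟩
  obtain ⟨l, rfl⟩ : ∃ l, L = l + 1 := ⟨L - 1, by omega⟩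
  have e1 : l + 1 + (m + 2) - 1 = l + m + 2 := by omega
  rw [e1] at h ⊢
  have a1 := Nat.choose_succ_right_eq (l + m + 2) (m + 1)
  have a2 := Nat.choose_succ_right_eq (l + m + 2) m
  rw [show l + m + 2 - (m + 1) = l + 1 by omega] at a1
  rw [show l + m + 2 - m = l + 2 by omega] at a2
  rw [show m + 1 + 1 = m + 2 by omega] at a1
  rw [show m + 2 - 2 = m by omega, show m + 2 - 1 = m + 1 by omega]
  rw [← h] at a1
  have a3 : c * (m + 2) = (l + m + 2).choose (m + 1) := by
    apply Nat.eq_of_mul_eq_mul_left (show 0 < l + 1 by omega)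
    linarith
  rw [← a3] at a2
  apply Nat.eq_of_mul_eq_mul_left (show 0 < m + 2 by omega)
  have : (k * (m + 2)) * (l + m + 2).choose m = (l + 2) * (l + m + 2).choose m := by rw [hk]
  linarith

end CountAux

/-- The number of `k`-divisible non-crossing partitions of `{1,…,kn}` in which `1` and `2`
lie in the same block equals `(k/(n-1)) binom((k+1)n - 2, n - 2)`. -/
theorem count_one_two_same_block (n k : ℕ) (hn : 2 ≤ n) (hk : 1 ≤ k) :
    (n - 1) * (fil (NCdiv k n) (fun π => ∃ B ∈ π.parts,
        (⟨0, by nlinarith⟩ : Fin (k * n)) ∈ B ∧ (⟨1, by nlinarith⟩ : Fin (k * n)) ∈ B)).card =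
      k * Nat.choose ((k + 1) * n - 2) (n - 2) := by
  have h2 : 2 ≤ k * n := by nlinarith
  obtain ⟨L, hL⟩ : ∃ L, k * n = L + 1 := ⟨k * n - 1, by omega⟩
  have hL0 : 0 < L := by omega
  have hc := CountAux.card_good (k := k) (n := n) hL0 hL
  rw [← CountAux.card_partitions hL0 hk hL rfl
    (fil (NCdiv k n) (fun π => ∃ B ∈ π.parts,
        (⟨0, by nlinarith⟩ : Fin (k * n)) ∈ B ∧ (⟨1, by nlinarith⟩ : Fin (k * n)) ∈ B)) ?_] at hc
  · have := CountAux.choose_arith hn hL hL0 hc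
    rw [this]
    congr 2
    rw [add_mul, hL]
    omega
  · intro π
    rw [CountAux.mem_fil, NCdiv, CountAux.mem_fil, CountAux.code_dvd,
      CountAux.code_one, CountAux.extz, dif_pos (by omega)]
    simp
end
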